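/- arXiv:2407.17285 — 2 statements merged into one kernel-verified Lean document; each statement's English description precedes it below -/
import Mathlib

section
/- Let x̄ ∈ F be a feasible point of (MPSC) and assume that MPSC-PCRSC holds at x̄. Then the local error bound of (MPSC) holds at x̄, i.e., there exist ε > 0 and α > 0 such that dist(x, F) ≤ α·(Σ_{i=1}^m [max{g_i(x), 0}]² + Σ_{j=1}^p [h_j(x)]² + Σ_{k=1}^l min{[G_k(x)]², [H_k(x)]²})^{1/2} for all x with ‖x − x̄‖ < ε. -/
open Set Filter Topology Metric

noncomputable section

namespace MPSC

abbrev Vec (n : ℕ) := EuclideanSpace ℝ (Fin n)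

variable {n m p l : ℕ}

open scoped Classical in
/-- Sum of a function over an index set (finite ambient type). -/
noncomputable def sumOver {α β : Type*} [Fintype α] [AddCommMonoid β]
    (S : Set α) (v : α → β) : β :=
  ∑ a, if a ∈ S then v a else 0

/-- The feasible set of (MPSC). -/
def Feas (g : Fin m → Vec n → ℝ) (h : Fin p → Vec n → ℝ)
    (G H : Fin l → Vec n → ℝ) : Set (Vec n) :=
  {x | (∀ i, g i x ≤ 0) ∧ (∀ j, h j x = 0) ∧ ∀ k, G k x * H k x = 0}

/-- Index set of active inequality constraints. -/
def Ig (g : Fin m → Vec n → ℝ) (xb : Vec n) : Set (Fin m) := {i | g i xb = 0}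

def IG (G H : Fin l → Vec n → ℝ) (xb : Vec n) : Set (Fin l) :=
  {k | G k xb = 0 ∧ H k xb ≠ 0}

def IH (G H : Fin l → Vec n → ℝ) (xb : Vec n) : Set (Fin l) :=
  {k | G k xb ≠ 0 ∧ H k xb = 0}

def IGH (G H : Fin l → Vec n → ℝ) (xb : Vec n) : Set (Fin l) :=
  {k | G k xb = 0 ∧ H k xb = 0}

/-- (β1, β2) is a disjoint bipartition of I_GH. -/
def Partition (G H : Fin l → Vec n → ℝ) (xb : Vec n) (β1 β2 : Set (Fin l)) : Prop :=
  β1 ∩ β2 = ∅ ∧ β1 ∪ β2 = IGH G H xb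

/-- Branch feasible set. -/
def BranchFeas (g : Fin m → Vec n → ℝ) (h : Fin p → Vec n → ℝ)
    (G H : Fin l → Vec n → ℝ) (xb : Vec n) (β1 β2 : Set (Fin l)) : Set (Vec n) :=
  {x | (∀ i, g i x ≤ 0) ∧ (∀ j, h j x = 0) ∧
    (∀ k ∈ IG G H xb ∪ β1, G k x = 0) ∧ ∀ k ∈ IH G H xb ∪ β2, H k x = 0}

/-- Bouligand tangent cone, as defined in the paper. -/
def tangentCone (Ω : Set (Vec n)) (xb : Vec n) : Set (Vec n) :=
  {d | ∃ t : ℕ → ℝ, ∃ x : ℕ → Vec n, (∀ k, 0 ≤ t k) ∧ (∀ k, x k ∈ Ω) ∧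
    Tendsto x atTop (nhds xb) ∧ Tendsto (fun k => t k • (x k - xb)) atTop (nhds d)}

/-- MPSC linearization cone. -/
def LCone (g : Fin m → Vec n → ℝ) (h : Fin p → Vec n → ℝ)
    (G H : Fin l → Vec n → ℝ) (xb : Vec n) : Set (Vec n) :=
  {d | (∀ i ∈ Ig g xb, fderiv ℝ (g i) xb d ≤ 0) ∧ (∀ j, fderiv ℝ (h j) xb d = 0) ∧
    (∀ k ∈ IG G H xb, fderiv ℝ (G k) xb d = 0) ∧ (∀ k ∈ IH G H xb, fderiv ℝ (H k) xb d = 0) ∧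
    ∀ k ∈ IGH G H xb, fderiv ℝ (G k) xb d * fderiv ℝ (H k) xb d = 0}

/-- Branch linearization cone. -/
def BranchLCone (g : Fin m → Vec n → ℝ) (h : Fin p → Vec n → ℝ)
    (G H : Fin l → Vec n → ℝ) (xb : Vec n) (β1 β2 : Set (Fin l)) : Set (Vec n) :=
  {d | (∀ i ∈ Ig g xb, fderiv ℝ (g i) xb d ≤ 0) ∧ (∀ j, fderiv ℝ (h j) xb d = 0) ∧
    (∀ k ∈ IG G H xb ∪ β1, fderiv ℝ (G k) xb d = 0) ∧
    ∀ k ∈ IH G H xb ∪ β2, fderiv ℝ (H k) xb d = 0}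

/-- MPSC critical subspace. -/
def CritSubspace (g : Fin m → Vec n → ℝ) (h : Fin p → Vec n → ℝ)
    (G H : Fin l → Vec n → ℝ) (xb : Vec n) : Set (Vec n) :=
  {d | (∀ i ∈ Ig g xb, fderiv ℝ (g i) xb d = 0) ∧ (∀ j, fderiv ℝ (h j) xb d = 0) ∧
    (∀ k ∈ IG G H xb ∪ IGH G H xb, fderiv ℝ (G k) xb d = 0) ∧
    ∀ k ∈ IH G H xb ∪ IGH G H xb, fderiv ℝ (H k) xb d = 0}

/-- Rank (dimension of the span) of the family of gradients
{∇g_i(x)}_{i∈I1} ∪ {∇h_j(x)}_j ∪ {∇G_k(x)}_{k∈I3} ∪ {∇H_k(x)}_{k∈I4}. -/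
def gradRank (g : Fin m → Vec n → ℝ) (h : Fin p → Vec n → ℝ)
    (G H : Fin l → Vec n → ℝ) (I1 : Set (Fin m)) (I3 I4 : Set (Fin l)) (x : Vec n) : ℕ :=
  Module.finrank ℝ ↥(Submodule.span ℝ
    ((fun i => gradient (g i) x) '' I1 ∪ Set.range (fun j => gradient (h j) x) ∪
     (fun k => gradient (G k) x) '' I3 ∪ (fun k => gradient (H k) x) '' I4))

/-- MPSC-LICQ. -/
def LICQ (g : Fin m → Vec n → ℝ) (h : Fin p → Vec n → ℝ)
    (G H : Fin l → Vec n → ℝ) (xb : Vec n) : Prop :=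
  ∀ (lam : Fin m → ℝ) (ρ : Fin p → ℝ) (μ ν : Fin l → ℝ),
    (∀ i, i ∉ Ig g xb → lam i = 0) →
    (∀ k, k ∉ IG G H xb ∪ IGH G H xb → μ k = 0) →
    (∀ k, k ∉ IH G H xb ∪ IGH G H xb → ν k = 0) →
    ∑ i, lam i • gradient (g i) xb + ∑ j, ρ j • gradient (h j) xb +
      ∑ k, μ k • gradient (G k) xb + ∑ k, ν k • gradient (H k) xb = 0 →
    lam = 0 ∧ ρ = 0 ∧ μ = 0 ∧ ν = 0

/-- MPSC-RCRCQ. -/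
def RCRCQ (g : Fin m → Vec n → ℝ) (h : Fin p → Vec n → ℝ)
    (G H : Fin l → Vec n → ℝ) (xb : Vec n) : Prop :=
  ∃ ε > (0:ℝ), ∀ I1 : Set (Fin m), I1 ⊆ Ig g xb →
    ∀ I3 I4 : Set (Fin l), I3 ⊆ IGH G H xb → I4 ⊆ IGH G H xb →
      ∀ x : Vec n, ‖x - xb‖ < ε →
        gradRank g h G H I1 (I3 ∪ IG G H xb) (I4 ∪ IH G H xb) x =
        gradRank g h G H I1 (I3 ∪ IG G H xb) (I4 ∪ IH G H xb) xb

/-- MPSC-WCR. -/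
def WCR (g : Fin m → Vec n → ℝ) (h : Fin p → Vec n → ℝ)
    (G H : Fin l → Vec n → ℝ) (xb : Vec n) : Prop :=
  ∃ ε > (0:ℝ), ∀ x : Vec n, ‖x - xb‖ < ε →
    gradRank g h G H (Ig g xb) (IG G H xb ∪ IGH G H xb) (IH G H xb ∪ IGH G H xb) x =
    gradRank g h G H (Ig g xb) (IG G H xb ∪ IGH G H xb) (IH G H xb ∪ IGH G H xb) xb

/-- MPSC-PWCR. -/
def PWCR (g : Fin m → Vec n → ℝ) (h : Fin p → Vec n → ℝ)
    (G H : Fin l → Vec n → ℝ) (xb : Vec n) : Prop :=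
  ∀ β1 β2 : Set (Fin l), Partition G H xb β1 β2 →
    ∃ ε > (0:ℝ), ∀ x : Vec n, ‖x - xb‖ < ε →
      gradRank g h G H (Ig g xb) (IG G H xb ∪ β1) (IH G H xb ∪ β2) x =
      gradRank g h G H (Ig g xb) (IG G H xb ∪ β1) (IH G H xb ∪ β2) xb

/-- The index set I_g^- associated with a branch (β1, β2). -/
def IgMinus (g : Fin m → Vec n → ℝ) (h : Fin p → Vec n → ℝ)
    (G H : Fin l → Vec n → ℝ) (xb : Vec n) (β1 β2 : Set (Fin l)) : Set (Fin m) :=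
  {i | i ∈ Ig g xb ∧ ∃ (lam : Fin m → ℝ) (ρ : Fin p → ℝ) (μ ν : Fin l → ℝ),
    (∀ i', 0 ≤ lam i') ∧ (∀ i', i' ∉ Ig g xb \ {i} → lam i' = 0) ∧
    (∀ k, k ∉ IG G H xb ∪ β1 → μ k = 0) ∧ (∀ k, k ∉ IH G H xb ∪ β2 → ν k = 0) ∧
    -gradient (g i) xb = ∑ i', lam i' • gradient (g i') xb + ∑ j, ρ j • gradient (h j) xb +
      ∑ k, μ k • gradient (G k) xb + ∑ k, ν k • gradient (H k) xb}

/-- MPSC-PCRSC. -/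
def PCRSC (g : Fin m → Vec n → ℝ) (h : Fin p → Vec n → ℝ)
    (G H : Fin l → Vec n → ℝ) (xb : Vec n) : Prop :=
  ∀ β1 β2 : Set (Fin l), Partition G H xb β1 β2 →
    ∃ ε > (0:ℝ), ∀ x : Vec n, ‖x - xb‖ < ε →
      gradRank g h G H (IgMinus g h G H xb β1 β2) (IG G H xb ∪ β1) (IH G H xb ∪ β2) x =
      gradRank g h G H (IgMinus g h G H xb β1 β2) (IG G H xb ∪ β1) (IH G H xb ∪ β2) xb

/-- A twice differentiable arc on [0, δ) (one-sided at the endpoint 0),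
with first derivative ξ'. -/
def TwiceDiffArc (δ : ℝ) (ξ ξ' : ℝ → Vec n) : Prop :=
  (∀ t ∈ Ico (0:ℝ) δ, HasDerivWithinAt ξ (ξ' t) (Ico (0:ℝ) δ) t) ∧
  ∀ t ∈ Ico (0:ℝ) δ, DifferentiableWithinAt ℝ ξ' (Ico (0:ℝ) δ) t

/-- MPSC-SSOCQ. -/
def SSOCQ (g : Fin m → Vec n → ℝ) (h : Fin p → Vec n → ℝ)
    (G H : Fin l → Vec n → ℝ) (xb : Vec n) : Prop :=
  ∀ d ∈ LCone g h G H xb, d ≠ 0 →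
    ∃ δ > (0:ℝ), ∃ J K : Set (Fin l), J ⊆ IGH G H xb ∧ K ⊆ IGH G H xb ∧
      ∃ ξ ξ' : ℝ → Vec n, TwiceDiffArc δ ξ ξ' ∧
        (∀ t ∈ Ico (0:ℝ) δ, ξ t ∈ Feas g h G H) ∧
        ξ 0 = xb ∧ ξ' 0 = d ∧
        (∀ t ∈ Ico (0:ℝ) δ, ∀ i ∈ Ig g xb, fderiv ℝ (g i) xb d = 0 → g i (ξ t) = 0) ∧
        (∀ t ∈ Ico (0:ℝ) δ, ∀ k ∈ IG G H xb ∪ J, G k (ξ t) = 0) ∧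
        ∀ t ∈ Ico (0:ℝ) δ, ∀ k ∈ IH G H xb ∪ K, H k (ξ t) = 0

/-- MPSC-WSOCQ. -/
def WSOCQ (g : Fin m → Vec n → ℝ) (h : Fin p → Vec n → ℝ)
    (G H : Fin l → Vec n → ℝ) (xb : Vec n) : Prop :=
  ∀ d ∈ CritSubspace g h G H xb, d ≠ 0 →
    ∃ δ > (0:ℝ), ∃ J K : Set (Fin l), J ⊆ IGH G H xb ∧ K ⊆ IGH G H xb ∧
      ∃ ζ ζ' : ℝ → Vec n, TwiceDiffArc δ ζ ζ' ∧
        (∀ t ∈ Ico (0:ℝ) δ, ζ t ∈ Feas g h G H) ∧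
        ζ 0 = xb ∧ ζ' 0 = d ∧
        (∀ t ∈ Ico (0:ℝ) δ, ∀ i ∈ Ig g xb, g i (ζ t) = 0) ∧
        (∀ t ∈ Ico (0:ℝ) δ, ∀ k ∈ IG G H xb ∪ J, G k (ζ t) = 0) ∧
        ∀ t ∈ Ico (0:ℝ) δ, ∀ k ∈ IH G H xb ∪ K, H k (ζ t) = 0

/-- The S-stationarity system for multipliers (λ, ρ, μ, ν) at xb. -/
def SStationarySystem (f : Vec n → ℝ) (g : Fin m → Vec n → ℝ) (h : Fin p → Vec n → ℝ)
    (G H : Fin l → Vec n → ℝ) (xb : Vec n)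
    (lam : Fin m → ℝ) (ρ : Fin p → ℝ) (μ ν : Fin l → ℝ) : Prop :=
  (∀ i, 0 ≤ lam i) ∧ (∀ i, lam i * g i xb = 0) ∧
  (∀ k ∈ IH G H xb ∪ IGH G H xb, μ k = 0) ∧
  (∀ k ∈ IG G H xb ∪ IGH G H xb, ν k = 0) ∧
  gradient f xb + ∑ i, lam i • gradient (g i) xb + ∑ j, ρ j • gradient (h j) xb +
    ∑ k, μ k • gradient (G k) xb + ∑ k, ν k • gradient (H k) xb = 0

def SStationary (f : Vec n → ℝ) (g : Fin m → Vec n → ℝ) (h : Fin p → Vec n → ℝ)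
    (G H : Fin l → Vec n → ℝ) (xb : Vec n) : Prop :=
  ∃ (lam : Fin m → ℝ) (ρ : Fin p → ℝ) (μ ν : Fin l → ℝ),
    SStationarySystem f g h G H xb lam ρ μ ν

/-- The M-stationarity system for multipliers (λ, ρ, μ, ν) at xb. -/
def MStationarySystem (f : Vec n → ℝ) (g : Fin m → Vec n → ℝ) (h : Fin p → Vec n → ℝ)
    (G H : Fin l → Vec n → ℝ) (xb : Vec n)
    (lam : Fin m → ℝ) (ρ : Fin p → ℝ) (μ ν : Fin l → ℝ) : Prop :=
  (∀ i, 0 ≤ lam i) ∧ (∀ i, lam i * g i xb = 0) ∧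
  (∀ k ∈ IH G H xb, μ k = 0) ∧ (∀ k ∈ IG G H xb, ν k = 0) ∧
  (∀ k ∈ IGH G H xb, μ k * ν k = 0) ∧
  gradient f xb + ∑ i, lam i • gradient (g i) xb + ∑ j, ρ j • gradient (h j) xb +
    ∑ k, μ k • gradient (G k) xb + ∑ k, ν k • gradient (H k) xb = 0

def MStationary (f : Vec n → ℝ) (g : Fin m → Vec n → ℝ) (h : Fin p → Vec n → ℝ)
    (G H : Fin l → Vec n → ℝ) (xb : Vec n) : Prop :=
  ∃ (lam : Fin m → ℝ) (ρ : Fin p → ℝ) (μ ν : Fin l → ℝ),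
    MStationarySystem f g h G H xb lam ρ μ ν

/-- Local optimality for (MPSC). -/
def LocallyOptimal (f : Vec n → ℝ) (g : Fin m → Vec n → ℝ) (h : Fin p → Vec n → ℝ)
    (G H : Fin l → Vec n → ℝ) (xb : Vec n) : Prop :=
  xb ∈ Feas g h G H ∧ ∃ ε > (0:ℝ), ∀ x ∈ Feas g h G H, ‖x - xb‖ < ε → f xb ≤ f x

/-- Hessian quadratic form dᵀ∇²φ(x)d. -/
def hessForm (φ : Vec n → ℝ) (x d : Vec n) : ℝ :=
  iteratedFDeriv ℝ 2 φ x ![d, d]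

/-- The Lagrange function ℓ. -/
def lagr (f : Vec n → ℝ) (g : Fin m → Vec n → ℝ) (h : Fin p → Vec n → ℝ)
    (G H : Fin l → Vec n → ℝ)
    (lam : Fin m → ℝ) (ρ : Fin p → ℝ) (μ ν : Fin l → ℝ) : Vec n → ℝ :=
  fun x => f x + ∑ i, lam i * g i x + ∑ j, ρ j * h j x +
    ∑ k, μ k * G k x + ∑ k, ν k * H k x

/-- Constraint-violation residual. -/
def residual (g : Fin m → Vec n → ℝ) (h : Fin p → Vec n → ℝ)
    (G H : Fin l → Vec n → ℝ) (x : Vec n) : ℝ :=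
  Real.sqrt (∑ i, max (g i x) 0 ^ 2 + ∑ j, h j x ^ 2 + ∑ k, min (G k x ^ 2) (H k x ^ 2))

/-- Penalty function P_κ. -/
def Pen (f : Vec n → ℝ) (g : Fin m → Vec n → ℝ) (h : Fin p → Vec n → ℝ)
    (G H : Fin l → Vec n → ℝ) (κ : ℝ) (x : Vec n) : ℝ :=
  f x + κ * residual g h G H x

/-- MPSC piecewise second-order quasi-normality. -/
def PSOQN (g : Fin m → Vec n → ℝ) (h : Fin p → Vec n → ℝ)
    (G H : Fin l → Vec n → ℝ) (xb : Vec n) : Prop :=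
  ∀ β1 β2 : Set (Fin l), Partition G H xb β1 β2 →
    ¬ ∃ (lam : Fin m → ℝ) (ρ : Fin p → ℝ) (μ ν : Fin l → ℝ),
      (∀ i, 0 ≤ lam i) ∧
      (∀ k, k ∉ IG G H xb ∪ β1 → μ k = 0) ∧ (∀ k, k ∉ IH G H xb ∪ β2 → ν k = 0) ∧
      ¬(lam = 0 ∧ ρ = 0 ∧ μ = 0 ∧ ν = 0) ∧
      (∑ i, lam i • gradient (g i) xb + ∑ j, ρ j • gradient (h j) xb +
        ∑ k, μ k • gradient (G k) xb + ∑ k, ν k • gradient (H k) xb = 0) ∧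
      (∀ d : Vec n, (∀ i ∈ Ig g xb, fderiv ℝ (g i) xb d = 0) →
        (∀ j, fderiv ℝ (h j) xb d = 0) →
        (∀ k ∈ IG G H xb ∪ β1, fderiv ℝ (G k) xb d = 0) →
        (∀ k ∈ IH G H xb ∪ β2, fderiv ℝ (H k) xb d = 0) →
        0 ≤ ∑ i, lam i * hessForm (g i) xb d + ∑ j, ρ j * hessForm (h j) xb d +
          ∑ k, μ k * hessForm (G k) xb d + ∑ k, ν k * hessForm (H k) xb d) ∧
      ∃ xs : ℕ → Vec n, Tendsto xs atTop (nhds xb) ∧ ∀ s,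
        (∀ i, 0 < lam i → 0 < lam i * g i (xs s)) ∧
        (∀ j, ρ j ≠ 0 → 0 < ρ j * h j (xs s)) ∧
        (∀ k, μ k ≠ 0 → 0 < μ k * G k (xs s)) ∧
        (∀ k, ν k ≠ 0 → 0 < ν k * H k (xs s))

section
variable {E : Type*} [NormedAddCommGroup E] [InnerProductSpace ℝ E] [FiniteDimensional ℝ E]

lemma continuous_gradient {φ : E → ℝ} (hφ : ContDiff ℝ 1 φ) :
    Continuous (fun x => gradient φ x) := by
  unfold gradient
  exact (LinearIsometryEquiv.continuous _).comp (hφ.continuous_fderiv one_ne_zero)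

lemma inner_eq_zero_of_mem_span {E : Type*} [NormedAddCommGroup E] [InnerProductSpace ℝ E]
    {s : Set E} {u d : E} (hu : u ∈ Submodule.span ℝ s)
    (hs : ∀ v ∈ s, inner ℝ v d = 0) : inner ℝ u d = 0 := by
  induction hu using Submodule.span_induction with
  | mem x hx => exact hs x hx
  | zero => simp
  | add x y _ _ hx hy => rw [inner_add_left, hx, hy, add_zero]
  | smul c x _ hx => rw [inner_smul_left, hx, mul_zero]

/-- Under constant rank, a maximal linearly independent subfamily of the gradients at `x₀`
spans all the gradients at nearby points. -/
lemma exists_eventually_gradient_mem_span {τ : Type} [Finite τ] {φ : τ → E → ℝ}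
    (hφ : ∀ t, ContDiff ℝ 1 (φ t)) {x₀ : E}
    (hrank : ∀ᶠ x in 𝓝 x₀,
      Module.finrank ℝ (Submodule.span ℝ (range fun t => gradient (φ t) x)) =
      Module.finrank ℝ (Submodule.span ℝ (range fun t => gradient (φ t) x₀))) :
    ∃ (σ : Type) (_ : Fintype σ) (a : σ → τ),
      LinearIndependent ℝ (fun s => gradient (φ (a s)) x₀) ∧
      ∀ᶠ x in 𝓝 x₀, ∀ t,
        gradient (φ t) x ∈ Submodule.span ℝ (range fun s => gradient (φ (a s)) x) := by
  obtain ⟨σ, a, ha, hspan, hli⟩ := exists_linearIndependent' ℝ (fun t => gradient (φ t) x₀)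
  have : Finite σ := Finite.of_injective a ha
  have : Fintype σ := Fintype.ofFinite σ
  refine ⟨σ, inferInstance, a, hli, ?_⟩
  have hcont : Continuous (fun x => fun s => gradient (φ (a s)) x) :=
    continuous_pi fun s => continuous_gradient (hφ (a s))
  have hopen : ∀ᶠ x in 𝓝 x₀, LinearIndependent ℝ (fun s => gradient (φ (a s)) x) :=
    hcont.continuousAt.eventually (isOpen_setOfPred_linearIndependent.mem_nhds hli)
  filter_upwards [hrank, hopen] with x hx hlx t
  have hle : Submodule.span ℝ (range fun s => gradient (φ (a s)) x) ≤
      Submodule.span ℝ (range fun t => gradient (φ t) x) := by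
    apply Submodule.span_mono
    rintro _ ⟨s, rfl⟩
    exact ⟨a s, rfl⟩
  have heq := Submodule.eq_of_le_of_finrank_eq hle (by
    rw [hx, ← hspan, finrank_span_eq_card hlx]
    exact (finrank_span_eq_card hli).symm)
  rw [heq]
  exact Submodule.subset_span ⟨t, rfl⟩

/-- A straightening chart: the functions of a constant rank family depend, in suitable
coordinates, only on the values of a subfamily. -/
lemma exists_straightening {τ : Type} [Finite τ] {φ : τ → E → ℝ}
    (hφ : ∀ t, ContDiff ℝ 1 (φ t)) {x₀ : E}
    (hrank : ∀ᶠ x in 𝓝 x₀,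
      Module.finrank ℝ (Submodule.span ℝ (range fun t => gradient (φ t) x)) =
      Module.finrank ℝ (Submodule.span ℝ (range fun t => gradient (φ t) x₀)))
    {K : Submodule ℝ E} (hK : ∀ d, d ∈ K ↔ ∀ t, inner ℝ (gradient (φ t) x₀) d = 0) :
    ∃ (σ : Type) (_ : Fintype σ) (a : σ → τ) (S : (σ → ℝ) × K → E)
      (S' : (σ → ℝ) × K →L[ℝ] E) (w : E → K),
      S 0 = x₀ ∧ HasStrictFDerivAt S S' 0 ∧ (∀ d : K, S' (0, d) = d) ∧
      Continuous w ∧ w x₀ = 0 ∧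
      (∀ᶠ x in 𝓝 x₀, S (fun s => φ (a s) x - φ (a s) x₀, w x) = x) ∧
      ∀ᶠ u in 𝓝 (0 : (σ → ℝ) × K), ∀ t, φ t (S u) = φ t (S (u.1, 0)) := by
  obtain ⟨σ, _, a, hli, hspan⟩ := exists_eventually_gradient_mem_span hφ hrank
  have hKspan : K = (Submodule.span ℝ (range fun s => gradient (φ (a s)) x₀))ᗮ := by
    ext d
    rw [hK, Submodule.mem_orthogonal]
    constructor
    · intro hd u hu
      exact inner_eq_zero_of_mem_span hu (forall_mem_range.2 fun s => hd _)
    · intro hd t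
      exact hd _ (hspan.self_of_nhds t)
  let w : E → K := fun x => K.orthogonalProjectionOnto (x - x₀)
  let T : E → (σ → ℝ) × K := fun x => (fun s => φ (a s) x - φ (a s) x₀, w x)
  let T' : E →L[ℝ] (σ → ℝ) × K :=
    (ContinuousLinearMap.pi fun s => fderiv ℝ (φ (a s)) x₀).prod K.orthogonalProjectionOnto
  have hTsm : ContDiff ℝ 1 T := by
    refine ContDiff.prodMk (contDiff_pi.2 fun s => (hφ (a s)).sub contDiff_const) ?_
    exact K.orthogonalProjectionOnto.contDiff.comp (contDiff_id.sub contDiff_const)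
  have hTd : ∀ x, HasFDerivAt T
      ((ContinuousLinearMap.pi fun s => fderiv ℝ (φ (a s)) x).prod K.orthogonalProjectionOnto) x := by
    intro x
    refine HasFDerivAt.prodMk (hasFDerivAt_pi.2 fun s => ?_) ?_
    · exact (((hφ (a s)).differentiable one_ne_zero x).hasFDerivAt).sub_const _
    · exact K.orthogonalProjectionOnto.hasFDerivAt.comp x ((hasFDerivAt_id x).sub_const x₀)
  have hinj : Function.Injective T' := by
    rw [injective_iff_map_eq_zero]
    intro d hd
    have h1 : ∀ s, inner ℝ (gradient (φ (a s)) x₀) d = 0 := fun s => by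
      rw [inner_gradient_left]
      exact congrFun (congrArg Prod.fst hd) s
    have h2 : K.orthogonalProjectionOnto d = 0 := congrArg Prod.snd hd
    have h3 : d ∈ K := by
      rw [hKspan, Submodule.mem_orthogonal]
      exact fun u hu => inner_eq_zero_of_mem_span hu (forall_mem_range.2 h1)
    have h4 := Submodule.orthogonalProjectionOnto_mem_subspace_eq_self (⟨d, h3⟩ : K)
    rw [h2] at h4
    exact (congrArg Subtype.val h4).symm
  have hdim : Module.finrank ℝ E = Module.finrank ℝ ((σ → ℝ) × K) := by
    rw [Module.finrank_prod, Module.finrank_fintype_fun_eq_card, ← finrank_span_eq_card hli,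
      hKspan, Submodule.finrank_add_finrank_orthogonal]
  let e : E ≃L[ℝ] (σ → ℝ) × K :=
    (T'.toLinearMap.linearEquivOfInjective hinj hdim).toContinuousLinearEquiv
  have he : ∀ v, e v = T' v := fun v => rfl
  have heT : (e : E →L[ℝ] (σ → ℝ) × K) = T' := by ext1 v; exact he v
  have hTe : HasFDerivAt T (e : E →L[ℝ] (σ → ℝ) × K) x₀ := heT ▸ hTd x₀
  have hTs : HasStrictFDerivAt T (e : E →L[ℝ] (σ → ℝ) × K) x₀ :=
    hTsm.contDiffAt.hasStrictFDerivAt' hTe one_ne_zero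
  have hT0 : T x₀ = 0 := by
    simp only [T, w, sub_self, map_zero]
    rfl
  let S := hTs.localInverse T e x₀
  have hS0 : S 0 = x₀ := by rw [← hT0]; exact hTs.localInverse_apply_image
  have hSs : HasStrictFDerivAt S (e.symm : (σ → ℝ) × K →L[ℝ] E) 0 := hT0 ▸ hTs.to_localInverse
  have hSsm : ContDiffAt ℝ 1 S 0 :=
    hT0 ▸ hTsm.contDiffAt.to_localInverse hTe one_ne_zero
  refine ⟨σ, inferInstance, a, S, e.symm, w, hS0, hSs, ?_, ?_, by simp [w],
    hTs.eventually_left_inverse, ?_⟩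
  · intro d
    change e.symm (0, d) = d
    rw [ContinuousLinearEquiv.symm_apply_eq, he]
    refine Prod.ext ?_ (Submodule.orthogonalProjectionOnto_mem_subspace_eq_self d).symm
    funext s
    have := (hK d).1 d.2 (a s)
    rw [inner_gradient_left] at this
    exact this.symm
  · exact K.orthogonalProjectionOnto.continuous.comp (continuous_id.sub continuous_const)
  · have h1 : ∀ᶠ u in 𝓝 (0 : (σ → ℝ) × K), T (S u) = u := by
      have := hTs.eventually_right_inverse
      rwa [hT0] at this
    have h2 : ∀ᶠ u in 𝓝 (0 : (σ → ℝ) × K), DifferentiableAt ℝ S u :=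
      (hSsm.eventually (by simp)).mono fun u hu => hu.differentiableAt one_ne_zero
    have h3 := (hSs.continuousAt.tendsto.eventually (hS0.symm ▸ hspan))
    obtain ⟨δ, hδ, hball⟩ := Metric.eventually_nhds_iff_ball.1 (h1.eventually_nhds.and (h2.and h3))
    filter_upwards [Metric.ball_mem_nhds 0 hδ] with u hu t
    obtain ⟨y, z⟩ := u
    have hmem : ∀ z' ∈ Metric.ball (0 : K) δ, (y, z') ∈ Metric.ball (0 : (σ → ℝ) × K) δ := by
      intro z' hz'
      rw [mem_ball_zero_iff, Prod.norm_def, max_lt_iff] at *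
      exact ⟨hu.1, hz'⟩
    have hz : z ∈ Metric.ball (0 : K) δ := by
      rw [mem_ball_zero_iff, Prod.norm_def, max_lt_iff] at *
      exact hu.2
    have hder : ∀ z' ∈ Metric.ball (0 : K) δ,
        HasFDerivAt (fun z' => φ t (S (y, z'))) (0 : K →L[ℝ] ℝ) z' := by
      intro z' hz'
      obtain ⟨hTS, hSd, hsp⟩ := hball _ (hmem z' hz')
      have hin : HasFDerivAt (fun z' : K => (y, z')) (ContinuousLinearMap.inr ℝ (σ → ℝ) K) z' :=
        hasFDerivAt_prodMk_right y z'
      have hc := (((hφ t).differentiable one_ne_zero (S (y, z'))).hasFDerivAt).comp z'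
        (hSd.hasFDerivAt.comp z' hin)
      have hTS' : HasFDerivAt (fun u => T (S u)) (ContinuousLinearMap.id ℝ _) (y, z') :=
        (hasFDerivAt_id _).congr_of_eventuallyEq hTS
      have huniq := ((hTd (S (y, z'))).comp (y, z') hSd.hasFDerivAt).unique hTS'
      refine hc.congr_fderiv ?_
      ext v
      have hv := congrArg (fun L => L (0, v)) huniq
      have hv1 : ∀ s, inner ℝ (gradient (φ (a s)) (S (y, z')))
          (fderiv ℝ S (y, z') (0, v)) = 0 := by
        intro s
        rw [inner_gradient_left]
        exact congrFun (congrArg Prod.fst hv) s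
      change fderiv ℝ (φ t) (S (y, z')) (fderiv ℝ S (y, z') (0, v)) = 0
      rw [← inner_gradient_left]
      exact inner_eq_zero_of_mem_span (hsp t) (forall_mem_range.2 hv1)
    exact Metric.isOpen_ball.is_const_of_fderiv_eq_zero (convex_ball 0 δ).isPreconnected
      (fun z' hz' => (hder z' hz').differentiableAt.differentiableWithinAt)
      (fun z' hz' => (hder z' hz').fderiv) hz (mem_ball_self hδ)

/-- There is a nonnegative relation, supported on `A`, among the `a i` modulo the span of the `b j`
which has a positive coefficient at `i₀`. -/
def HasPosRelation {E ι κ : Type*} [AddCommGroup E] [Module ℝ E] [Fintype ι] [Fintype κ]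
    (a : κ → E) (b : ι → E) (A : Set κ) (i₀ : κ) : Prop :=
  ∃ (c : κ → ℝ) (r : ι → ℝ), (∀ i, 0 ≤ c i) ∧ (∀ i, i ∉ A → c i = 0) ∧ 0 < c i₀ ∧
    ∑ i, c i • a i + ∑ j, r j • b j = 0

lemma exists_relation_pos_iff {E ι κ : Type*} [AddCommGroup E] [Module ℝ E] [Fintype ι] [Fintype κ]
    (a : κ → E) (b : ι → E) (A : Set κ) :
    ∃ (c : κ → ℝ) (r : ι → ℝ), (∀ i, 0 ≤ c i) ∧ (∀ i, 0 < c i ↔ HasPosRelation a b A i) ∧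
      ∑ i, c i • a i + ∑ j, r j • b j = 0 := by
  have hex : ∀ i₀, ∃ (c : κ → ℝ) (r : ι → ℝ), (∀ i, 0 ≤ c i) ∧ (∀ i, i ∉ A → c i = 0) ∧
      (HasPosRelation a b A i₀ → 0 < c i₀) ∧ ∑ i, c i • a i + ∑ j, r j • b j = 0 := by
    intro i₀
    by_cases h : HasPosRelation a b A i₀
    · obtain ⟨c, r, h1, h2, h3, h4⟩ := h
      exact ⟨c, r, h1, h2, fun _ => h3, h4⟩
    · exact ⟨0, 0, by simp, by simp, fun h' => (h h').elim, by simp⟩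
  choose c r h1 h2 h3 h4 using hex
  have hnn : ∀ i, 0 ≤ ∑ k, c k i := fun i => Finset.sum_nonneg fun k _ => h1 k i
  have hrel : ∑ i, (∑ k, c k i) • a i + ∑ j, (∑ k, r k j) • b j = 0 := by
    simp_rw [Finset.sum_smul]
    rw [Finset.sum_comm, Finset.sum_comm (s := (Finset.univ : Finset ι)), ← Finset.sum_add_distrib]
    exact Finset.sum_eq_zero fun k _ => h4 k
  refine ⟨fun i => ∑ k, c k i, fun j => ∑ k, r k j, hnn, fun i => ⟨fun hi => ?_, fun hi => ?_⟩, hrel⟩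
  · exact ⟨_, _, hnn, fun i hi => Finset.sum_eq_zero fun k _ => h2 k i hi, hi, hrel⟩
  · exact Finset.sum_pos' (fun k _ => h1 k i) ⟨i, Finset.mem_univ _, h3 i hi⟩

/-- A theorem of the alternative: a direction along which all the linear forms `a i`, `i ∈ A`,
decrease strictly, except those which are forced to vanish. -/
lemma exists_descent_direction {ι κ : Type*} [Fintype ι] [Fintype κ]
    (a : κ → E) (b : ι → E) (A : Set κ) :
    ∃ d : E, (∀ j, inner ℝ (b j) d = 0) ∧ (∀ i, HasPosRelation a b A i → inner ℝ (a i) d = 0) ∧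
      ∀ i ∈ A, ¬ HasPosRelation a b A i → inner ℝ (a i) d < 0 := by
  classical
  obtain ⟨Λ, R, hΛ0, hΛ, hrel⟩ := exists_relation_pos_iff a b A
  set J : Set κ := {i | HasPosRelation a b A i} with hJ
  have hJA : ∀ i ∈ J, i ∈ A := by
    rintro i ⟨c, r, -, h2, h3, -⟩
    by_contra hi
    exact h3.ne' (h2 i hi)
  let a' : κ → E := fun i => if i ∈ J then a i else 0
  let V : Submodule ℝ E := Submodule.span ℝ (range b) ⊔ Submodule.span ℝ (range a')
  let K : Submodule ℝ E := Vᗮ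
  let P := K.orthogonalProjectionOnto
  let Δ : Set (κ → ℝ) := stdSimplex ℝ κ ∩ {c | ∀ k, ¬ (k ∈ A ∧ k ∉ J) → c k = 0}
  have hΔcl : IsClosed {c : κ → ℝ | ∀ k, ¬ (k ∈ A ∧ k ∉ J) → c k = 0} := by
    simp only [ofPred_forall]
    exact isClosed_iInter fun k => isClosed_iInter fun _ =>
      isClosed_eq (continuous_apply k) continuous_const
  have hΔc : IsCompact Δ := (isCompact_stdSimplex ℝ κ).inter_right hΔcl
  have hΔconv : Convex ℝ Δ := by
    refine (convex_stdSimplex ℝ κ).inter ?_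
    intro x hx y hy s t _ _ _ k hk
    simp [hx k hk, hy k hk]
  let L : (κ → ℝ) →ₗ[ℝ] K := Fintype.linearCombination ℝ (fun i => P (a i))
  have hL : ∀ c, L c = P (∑ i, c i • a i) := fun c => by
    simp [L, Fintype.linearCombination_apply, map_sum]
  have hLc : Continuous L := L.continuous_of_finiteDimensional
  have h0 : (0 : K) ∉ L '' Δ := by
    rintro ⟨c, ⟨⟨hc0, hc1⟩, hcs⟩, hc⟩
    have hmem : ∑ i, c i • a i ∈ V := by
      rw [hL] at hc
      have := Submodule.orthogonalProjectionOnto_eq_zero_iff.1 hc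
      rwa [Submodule.orthogonal_orthogonal] at this
    obtain ⟨u, hu, v, hv, huv⟩ := Submodule.mem_sup.1 hmem
    obtain ⟨ρ, rfl⟩ := (Submodule.mem_span_range_iff_exists_fun ℝ).1 hu
    obtain ⟨α, rfl⟩ := (Submodule.mem_span_range_iff_exists_fun ℝ).1 hv
    let β : κ → ℝ := fun i => if i ∈ J then α i else 0
    have hβ : ∑ i, α i • a' i = ∑ i, β i • a i := by
      refine Finset.sum_congr rfl fun i _ => ?_
      simp only [a', β]
      split_ifs <;> simp
    rw [hβ] at huv
    let N : ℝ := ∑ i, |β i| / Λ i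
    have hN : ∀ i, β i ≤ N * Λ i := by
      intro i
      by_cases hi : i ∈ J
      · have hpos : 0 < Λ i := (hΛ i).2 hi
        have : |β i| / Λ i ≤ N := Finset.single_le_sum (f := fun i => |β i| / Λ i)
          (fun k _ => div_nonneg (abs_nonneg _) (hΛ0 k)) (Finset.mem_univ i)
        rw [div_le_iff₀ hpos] at this
        exact (le_abs_self _).trans this
      · have hz : Λ i = 0 := le_antisymm (not_lt.1 fun h => hi ((hΛ i).1 h)) (hΛ0 i)
        simp [β, hi, hz]
    obtain ⟨k, -, hk⟩ : ∃ k ∈ Finset.univ, 0 < c k := by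
      by_contra! hcon
      have := Finset.sum_nonpos hcon
      linarith
    have hkAJ : k ∈ A ∧ k ∉ J := by
      by_contra hcon
      exact hk.ne' (hcs k hcon)
    refine hkAJ.2 ⟨fun i => c i - β i + N * Λ i, fun j => N * R j - ρ j, fun i => ?_, fun i hi => ?_,
      ?_, ?_⟩
    · linarith [hc0 i, hN i]
    · have hiJ : i ∉ J := fun h => hi (hJA i h)
      have hz : Λ i = 0 := le_antisymm (not_lt.1 fun h => hiJ ((hΛ i).1 h)) (hΛ0 i)
      simp [β, hiJ, hz, hcs i (fun h => hi h.1)]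
    · linarith [hN k]
    · simp only [add_smul, sub_smul, mul_smul, Finset.sum_add_distrib, Finset.sum_sub_distrib,
        ← Finset.smul_sum]
      rw [← huv]
      have : N • (∑ i, Λ i • a i + ∑ j, R j • b j) = 0 := by rw [hrel, smul_zero]
      rw [smul_add] at this
      rw [← this]
      abel
  obtain ⟨f, u, hfu, hft⟩ := geometric_hahn_banach_point_closed (hΔconv.linear_image L)
    (hΔc.image hLc).isClosed h0
  rw [map_zero] at hfu
  obtain ⟨z, hz⟩ : ∃ z : K, ∀ v, inner ℝ z v = f v :=
    ⟨(InnerProductSpace.toDual ℝ K).symm f, fun v => InnerProductSpace.toDual_symm_apply⟩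
  have hzV : ∀ v ∈ V, inner ℝ v (z : E) = 0 := (Submodule.mem_orthogonal _ _).1 z.2
  refine ⟨-(z : E), fun j => ?_, fun i hi => ?_, fun i hiA hi => ?_⟩
  · rw [inner_neg_right, hzV _ (Submodule.mem_sup_left (Submodule.subset_span ⟨j, rfl⟩)), neg_zero]
  · have : a' i = a i := if_pos hi
    rw [inner_neg_right, ← this,
      hzV _ (Submodule.mem_sup_right (Submodule.subset_span ⟨i, rfl⟩)), neg_zero]
  · have hmem : Pi.single i (1 : ℝ) ∈ Δ := by
      refine ⟨single_mem_stdSimplex ℝ i, fun k hk => ?_⟩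
      have : k ≠ i := by rintro rfl; exact hk ⟨hiA, hi⟩
      simp [this]
    have h1 := hft _ (mem_image_of_mem L hmem)
    have h2 : L (Pi.single i 1) = P (a i) := by simp [L]
    rw [h2, ← hz, real_inner_comm] at h1
    have h3 : inner ℝ (P (a i)) z = inner ℝ (a i) (z : E) :=
      Submodule.inner_orthogonalProjectionOnto_eq_of_mem_right _ _
    rw [inner_neg_right]
    linarith

/-- An error bound for the system `e = 0`, `g ≤ 0` under the relaxed constant rank condition: the rank
is constant for the gradients of `e` and of those active `g i` which enter a positive relation. -/
lemma error_bound_of_constant_rank {ι κ : Type} [Fintype ι] [Fintype κ]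
    {e : ι → E → ℝ} {g : κ → E → ℝ} (he : ∀ j, ContDiff ℝ 1 (e j)) (hg : ∀ i, ContDiff ℝ 1 (g i))
    {x₀ : E} (he₀ : ∀ j, e j x₀ = 0) (hg₀ : ∀ i, g i x₀ ≤ 0) {J : Set κ}
    (hJ : ∀ i, i ∈ J ↔ HasPosRelation (fun i => gradient (g i) x₀) (fun j => gradient (e j) x₀)
      {i | g i x₀ = 0} i)
    (hrank : ∀ᶠ x in 𝓝 x₀,
      Module.finrank ℝ (Submodule.span ℝ
        ((range fun j => gradient (e j) x) ∪ (fun i => gradient (g i) x) '' J)) =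
      Module.finrank ℝ (Submodule.span ℝ
        ((range fun j => gradient (e j) x₀) ∪ (fun i => gradient (g i) x₀) '' J))) :
    ∃ C : ℝ, ∀ᶠ x in 𝓝 x₀, ∃ z, (∀ j, e j z = 0) ∧ (∀ i, g i z ≤ 0) ∧
      dist x z ≤ C * (∑ j, |e j x| + ∑ i, max (g i x) 0) := by
  classical
  obtain ⟨Λ, r, hΛ0, hΛ, hrel⟩ := exists_relation_pos_iff (fun i => gradient (g i) x₀)
    (fun j => gradient (e j) x₀) {i | g i x₀ = 0}
  obtain ⟨d, hde, hdJ, hdA⟩ := exists_descent_direction (fun i => gradient (g i) x₀)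
    (fun j => gradient (e j) x₀) {i | g i x₀ = 0}
  simp only [← hJ] at hΛ hdJ hdA
  have hJA : ∀ i ∈ J, g i x₀ = 0 := by
    intro i hi
    obtain ⟨c, r, -, h2, h3, -⟩ := (hJ i).1 hi
    by_contra hne
    exact h3.ne' (h2 i hne)
  have hΛz : ∀ i, i ∉ J → Λ i = 0 := fun i hi =>
    le_antisymm (not_lt.1 fun h => hi ((hΛ i).1 h)) (hΛ0 i)
  let φ : ι ⊕ J → E → ℝ := Sum.elim e fun i => g i
  have hφ : ∀ t, ContDiff ℝ 1 (φ t) := Sum.rec he fun i => hg i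
  have hφ₀ : ∀ t, φ t x₀ = 0 := Sum.rec he₀ fun i => hJA i i.2
  have hrange : ∀ x, (range fun t => gradient (φ t) x) =
      (range fun j => gradient (e j) x) ∪ (fun i => gradient (g i) x) '' J := by
    intro x
    ext v
    simp [φ]
  have hrankφ : ∀ᶠ x in 𝓝 x₀, Set.finrank ℝ (range fun t => gradient (φ t) x) =
      Set.finrank ℝ (range fun t => gradient (φ t) x₀) := by
    simp only [hrange]
    exact hrank
  let K : Submodule ℝ E := (Submodule.span ℝ (range fun t => gradient (φ t) x₀))ᗮ
  have hK : ∀ d, d ∈ K ↔ ∀ t, inner ℝ (gradient (φ t) x₀) d = 0 := by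
    intro d
    rw [Submodule.mem_orthogonal]
    exact ⟨fun h t => h _ (Submodule.subset_span ⟨t, rfl⟩),
      fun h u hu => inner_eq_zero_of_mem_span hu (forall_mem_range.2 h)⟩
  have hdK : d ∈ K := (hK d).2 (Sum.rec hde fun i => hdJ i i.2)
  let d' : K := ⟨d, hdK⟩
  obtain ⟨σ, _, a, S, S', w, hS0, hS, hSK, hwc, hw0, hSx, hSφ⟩ := exists_straightening hφ hrankφ hK
  simp only [hφ₀, sub_zero] at hSx
  let y : E → σ → ℝ := fun x s => φ (a s) x
  have hyc : Continuous y := continuous_pi fun s => (hφ (a s)).continuous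
  have hy0 : y x₀ = 0 := funext fun s => hφ₀ (a s)
  let R : E → ℝ := fun x => ∑ j, |e j x| + ∑ i, max (g i x) 0
  have hRc : Continuous R := by
    refine (continuous_finsetSum _ fun j _ => (he j).continuous.abs).add
      (continuous_finsetSum _ fun i _ => (hg i).continuous.max continuous_const)
  have hR0 : R x₀ = 0 := by simp [R, he₀, hg₀]
  have hRnn : ∀ x, 0 ≤ R x := fun x => by positivity
  have heR : ∀ x j, |e j x| ≤ ∑ j, |e j x| := fun x j =>
    Finset.single_le_sum (f := fun j => |e j x|) (fun k _ => abs_nonneg _) (Finset.mem_univ j)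
  have hgR : ∀ x i, max (g i x) 0 ≤ ∑ i, max (g i x) 0 := fun x i =>
    Finset.single_le_sum (f := fun i => max (g i x) 0) (fun k _ => le_max_right _ _)
      (Finset.mem_univ i)
  -- the coordinates `(y x, w x)` of `x`
  have hv : Tendsto (fun x => (y x, w x)) (𝓝 x₀) (𝓝 (0 : (σ → ℝ) × K)) := by
    have := (hyc.prodMk hwc).tendsto x₀
    simp only [hy0, hw0] at this
    exact this
  -- bound on the coordinates `y` by the residual
  obtain ⟨C₁, hC₁0, hC₁⟩ : ∃ C₁, 0 ≤ C₁ ∧ ∀ᶠ x in 𝓝 x₀, ‖y x‖ ≤ C₁ * R x := by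
    let M : E → ℝ := fun x => ∑ j, |e j x| + ∑ i, if i ∈ J then |g i x| else 0
    have hyM : ∀ x, ‖y x‖ ≤ M x := by
      intro x
      have h1 : 0 ≤ ∑ j, |e j x| := Finset.sum_nonneg fun j _ => abs_nonneg _
      have h2 : ∀ i, 0 ≤ if i ∈ J then |g i x| else 0 := fun i => by split_ifs <;> positivity
      have h3 : 0 ≤ ∑ i, if i ∈ J then |g i x| else 0 := Finset.sum_nonneg fun i _ => h2 i
      have h4 : ∀ t, |φ t x| ≤ M x := by
        rintro (j | ⟨i, hi⟩)
        · exact (heR x j).trans (le_add_of_nonneg_right h3)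
        · have := Finset.single_le_sum (f := fun i => if i ∈ J then |g i x| else 0)
            (fun k _ => h2 k) (Finset.mem_univ i)
          rw [if_pos hi] at this
          exact this.trans (le_add_of_nonneg_left h1)
      exact (pi_norm_le_iff_of_nonneg (add_nonneg h1 h3)).2 fun s => h4 (a s)
    let D : ℝ := ∑ i, (Λ i)⁻¹
    have hD0 : 0 ≤ D := Finset.sum_nonneg fun i _ => inv_nonneg.2 (hΛ0 i)
    have hD : ∀ i ∈ J, ∀ s : ℝ, 0 ≤ s → s ≤ D * (Λ i * s) := by
      intro i hi s hs
      have hpos := (hΛ i).2 hi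
      have h1 : (Λ i)⁻¹ ≤ D := Finset.single_le_sum (f := fun i => (Λ i)⁻¹)
        (fun k _ => inv_nonneg.2 (hΛ0 k)) (Finset.mem_univ i)
      calc s = (Λ i)⁻¹ * (Λ i * s) := by field_simp
        _ ≤ D * (Λ i * s) := by gcongr
    let B : ℝ := 2 * ∑ i, Λ i + ∑ j, |r j|
    have hB0 : 0 ≤ B := add_nonneg (mul_nonneg zero_le_two (Finset.sum_nonneg fun i _ => hΛ0 i))
      (Finset.sum_nonneg fun j _ => abs_nonneg _)
    let Φ : E → ℝ := fun x => ∑ i, Λ i * g i x + ∑ j, r j * e j x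
    have hΦd : HasFDerivAt Φ (0 : E →L[ℝ] ℝ) x₀ := by
      have h1 : HasFDerivAt Φ (∑ i, Λ i • fderiv ℝ (g i) x₀ + ∑ j, r j • fderiv ℝ (e j) x₀) x₀ := by
        refine HasFDerivAt.add (HasFDerivAt.fun_sum fun i _ => ?_)
          (HasFDerivAt.fun_sum fun j _ => ?_)
        · exact ((hg i).differentiable one_ne_zero x₀).hasFDerivAt.const_mul _
        · exact ((he j).differentiable one_ne_zero x₀).hasFDerivAt.const_mul _
      refine h1.congr_fderiv ?_
      have h2 := congrArg (InnerProductSpace.toDual ℝ E) hrel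
      simpa [map_add, map_sum, toDual_gradient] using h2
    have hΦ₀ : Φ x₀ = 0 := by
      have : ∀ i, Λ i * g i x₀ = 0 := fun i => by
        by_cases hi : i ∈ J
        · rw [hJA i hi, mul_zero]
        · rw [hΛz i hi, zero_mul]
      simp [Φ, this, he₀]
    have hΦS : HasFDerivAt (fun u => Φ (S u)) (0 : (σ → ℝ) × K →L[ℝ] ℝ) 0 := by
      have := HasFDerivAt.comp (0 : (σ → ℝ) × K) (hS0.symm ▸ hΦd) hS.hasFDerivAt
      simpa [Function.comp_def] using this
    have hε : (0 : ℝ) < 1 / (2 * (D + 1)) := by positivity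
    have hΦsmall := hΦS.isLittleO.def hε
    simp only [hS0, hΦ₀, sub_zero, zero_apply] at hΦsmall
    have hproj : Tendsto (fun u : (σ → ℝ) × K => (u.1, (0 : K))) (𝓝 0) (𝓝 0) := by
      have : Continuous (fun u : (σ → ℝ) × K => (u.1, (0 : K))) := by fun_prop
      exact this.tendsto 0
    refine ⟨2 * (1 + D * B), by positivity, ?_⟩
    filter_upwards [hv.eventually (hproj.eventually hΦsmall), hv.eventually hSφ, hSx]
      with x hx1 hx2 hx3
    have hSx3 : S (y x, w x) = x := hx3
    rw [hSx3] at hx2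
    have hΦx : Φ (S (y x, 0)) = Φ x := by
      simp only [Φ]
      congr 1
      · refine Finset.sum_congr rfl fun i _ => ?_
        by_cases hi : i ∈ J
        · have : g i x = g i (S (y x, 0)) := hx2 (Sum.inr ⟨i, hi⟩)
          rw [this]
        · simp [hΛz i hi]
      · refine Finset.sum_congr rfl fun j _ => ?_
        have : e j x = e j (S (y x, 0)) := hx2 (Sum.inl j)
        rw [this]
    have hnorm : ‖((y x, 0) : (σ → ℝ) × K)‖ = ‖y x‖ := by simp [Prod.norm_def]
    simp only [hΦx, hnorm, Real.norm_eq_abs] at hx1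
    have h5 : ∑ i, Λ i * |g i x| ≤ B * R x + 1 / (2 * (D + 1)) * M x := by
      have h6 : ∀ i, Λ i * |g i x| = 2 * (Λ i * max (g i x) 0) - Λ i * g i x := fun i => by
        rcases le_total (g i x) 0 with h | h
        · rw [abs_of_nonpos h, max_eq_right h]; ring
        · rw [abs_of_nonneg h, max_eq_left h]; ring
      have h7 : ∑ i, Λ i * |g i x| =
          2 * ∑ i, Λ i * max (g i x) 0 - Φ x + ∑ j, r j * e j x := by
        simp only [h6, Finset.sum_sub_distrib, ← Finset.mul_sum, Φ]
        ring
      have h8 : ∑ i, Λ i * max (g i x) 0 ≤ (∑ i, Λ i) * R x := by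
        rw [Finset.sum_mul]
        refine Finset.sum_le_sum fun i _ => mul_le_mul_of_nonneg_left ?_ (hΛ0 i)
        exact (hgR x i).trans (le_add_of_nonneg_left (Finset.sum_nonneg fun j _ => abs_nonneg _))
      have h9 : ∑ j, r j * e j x ≤ (∑ j, |r j|) * R x := by
        rw [Finset.sum_mul]
        refine Finset.sum_le_sum fun j _ => ?_
        refine (le_abs_self _).trans ?_
        rw [abs_mul]
        refine mul_le_mul_of_nonneg_left ?_ (abs_nonneg _)
        exact (heR x j).trans (le_add_of_nonneg_right
          (Finset.sum_nonneg fun i _ => le_max_right _ _))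
      have h10 : - Φ x ≤ 1 / (2 * (D + 1)) * M x :=
        (neg_le_abs _).trans (hx1.trans (mul_le_mul_of_nonneg_left (hyM x) hε.le))
      rw [h7]
      simp only [B]
      linarith
    have h11 : (∑ i, if i ∈ J then |g i x| else 0) ≤ D * ∑ i, Λ i * |g i x| := by
      rw [Finset.mul_sum]
      refine Finset.sum_le_sum fun i _ => ?_
      split_ifs with hi
      · exact hD i hi _ (abs_nonneg _)
      · simp [hΛz i hi]
    have hM0 : 0 ≤ M x := (norm_nonneg _).trans (hyM x)
    have h12 : ∑ j, |e j x| ≤ R x :=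
      le_add_of_nonneg_right (Finset.sum_nonneg fun i _ => le_max_right _ _)
    have h13 : D * (1 / (2 * (D + 1)) * M x) ≤ M x / 2 := by
      have : D * (1 / (2 * (D + 1))) ≤ 1 / 2 := by
        rw [mul_one_div, div_le_div_iff₀ (by positivity) (by norm_num)]
        linarith
      calc D * (1 / (2 * (D + 1)) * M x) = D * (1 / (2 * (D + 1))) * M x := by ring
        _ ≤ 1 / 2 * M x := by gcongr
        _ = M x / 2 := by ring
    have h14 : M x ≤ R x + D * (B * R x + 1 / (2 * (D + 1)) * M x) :=
      add_le_add h12 (h11.trans (mul_le_mul_of_nonneg_left h5 hD0))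
    refine (hyM x).trans ?_
    linarith
  -- the corrected points
  let u : ℝ → E → (σ → ℝ) × K := fun C x => (0, w x + (C * R x) • d')
  have hu : ∀ C, Tendsto (u C) (𝓝 x₀) (𝓝 0) := by
    intro C
    have hc : Continuous (u C) :=
      continuous_const.prodMk (hwc.add ((continuous_const.mul hRc).smul continuous_const))
    have := hc.tendsto x₀
    simpa only [u, hw0, hR0, mul_zero, zero_smul, add_zero, Prod.mk_zero_zero] using this
  have huv : ∀ C, 0 ≤ C → ∀ x, ‖u C x - (y x, w x)‖ ≤ ‖y x‖ + C * R x * ‖d‖ := by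
    intro C hC x
    have hn := hRnn x
    have h1 : u C x - (y x, w x) = (-y x, (C * R x) • d') := by simp [u]
    rw [h1, Prod.norm_def, norm_neg, norm_smul, Real.norm_of_nonneg (by positivity)]
    exact max_le_add_of_nonneg (norm_nonneg _) (by positivity)
  have huz : ∀ C, ∀ᶠ x in 𝓝 x₀, ∀ t, φ t (S (u C x)) = 0 := by
    intro C
    filter_upwards [(hu C).eventually hSφ] with x hx t
    rw [hx t]
    change φ t (S 0) = 0
    rw [hS0, hφ₀]
  have hneg : ∀ i, ∃ c, ∀ C, 0 ≤ C → c ≤ C → ∀ᶠ x in 𝓝 x₀, g i (S (u C x)) ≤ 0 := by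
    intro i
    by_cases hi : i ∈ J
    · exact ⟨0, fun C _ _ => (huz C).mono fun x hx => (hx (Sum.inr ⟨i, hi⟩)).le⟩
    by_cases hiA : g i x₀ = 0
    · have hq := hdA i hiA hi
      set q : ℝ := inner ℝ (gradient (g i) x₀) d with hqdef
      let G : (σ → ℝ) × K →L[ℝ] ℝ := (fderiv ℝ (g i) x₀).comp S'
      have hGd : HasStrictFDerivAt (fun u => g i (S u)) G 0 := by
        refine HasStrictFDerivAt.comp (0 : (σ → ℝ) × K) ?_ hS
        rw [hS0]
        exact (hg i).contDiffAt.hasStrictFDerivAt one_ne_zero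
      have hε : 0 < -q / (2 * (‖d‖ + 1)) := by
        have := norm_nonneg d
        apply div_pos <;> linarith
      set ε := -q / (2 * (‖d‖ + 1)) with hεdef
      have hεd : ε * ‖d‖ ≤ -q / 2 := by
        have h1 : ε * (‖d‖ + 1) = -q / 2 := by
          rw [hεdef]; field_simp
        linarith
      have hlo := hGd.isLittleO.def hε
      rw [show ((0, 0) : ((σ → ℝ) × K) × ((σ → ℝ) × K)) = 0 from rfl] at hlo
      refine ⟨2 * (1 + (‖G‖ + ε) * C₁) / (-q), fun C hC0 hC => ?_⟩
      rw [div_le_iff₀ (by linarith)] at hC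
      have htend : Tendsto (fun x => (u C x, (y x, w x))) (𝓝 x₀) (𝓝 0) := (hu C).prodMk_nhds hv
      filter_upwards [htend.eventually hlo, hSx, hC₁] with x hx1 hx2 hx3
      have hx2' : S (y x, w x) = x := hx2
      simp only [hx2', Real.norm_eq_abs] at hx1
      have hn := hRnn x
      have h1 := (le_abs_self _).trans (hx1.trans (mul_le_mul_of_nonneg_left (huv C hC0 x) hε.le))
      have h2 : G (u C x - (y x, w x)) ≤ ‖G‖ * ‖y x‖ + C * R x * q := by
        have h3 : u C x - (y x, w x) = (-y x, 0) + (C * R x) • ((0, d') : (σ → ℝ) × K) := by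
          simp [u]
        have h4 : G (0, d') = q := by
          change fderiv ℝ (g i) x₀ (S' (0, d')) = q
          rw [hSK, hqdef, inner_gradient_left]
        rw [h3, map_add, map_smul, h4, smul_eq_mul]
        gcongr
        refine (le_abs_self _).trans ((G.le_opNorm _).trans ?_)
        simp [Prod.norm_def]
      have h5 : g i x ≤ R x := (le_max_left _ _).trans ((hgR x i).trans
        (le_add_of_nonneg_left (Finset.sum_nonneg fun j _ => abs_nonneg _)))
      have h6 : (‖G‖ + ε) * ‖y x‖ ≤ (‖G‖ + ε) * (C₁ * R x) := by gcongr
      have h7 : C * R x * (ε * ‖d‖) ≤ C * R x * (-q / 2) := by gcongr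
      have h8 : 2 * (1 + (‖G‖ + ε) * C₁) * R x ≤ C * -q * R x := by gcongr
      linarith
    · have hlt : g i (S 0) < 0 := by
        rw [hS0]
        exact lt_of_le_of_ne (hg₀ i) hiA
      have hcont : ContinuousAt (fun u => g i (S u)) 0 :=
        (hg i).continuous.continuousAt.comp hS.continuousAt
      exact ⟨0, fun C _ _ => (hu C).eventually
        ((hcont.eventually_lt continuousAt_const hlt).mono fun _ h => h.le)⟩
  choose c hc using hneg
  let C₂ : ℝ := ∑ i, |c i|
  have hC₂0 : 0 ≤ C₂ := Finset.sum_nonneg fun i _ => abs_nonneg _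
  have hcC : ∀ i, c i ≤ C₂ := fun i => (le_abs_self _).trans
    (Finset.single_le_sum (f := fun i => |c i|) (fun k _ => abs_nonneg _) (Finset.mem_univ i))
  have hfeas : ∀ᶠ x in 𝓝 x₀, ∀ i, g i (S (u C₂ x)) ≤ 0 :=
    eventually_all.2 fun i => hc i C₂ hC₂0 (hcC i)
  obtain ⟨L, hL⟩ := hS.exists_lipschitzOnWith
  obtain ⟨s, hs, hLs⟩ := hL
  refine ⟨L * (C₁ + C₂ * ‖d‖), ?_⟩
  filter_upwards [hfeas, huz C₂, hSx, hC₁, (hu C₂).eventually hs, hv.eventually hs]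
    with x hx1 hx2 hx3 hx4 hx5 hx6
  refine ⟨S (u C₂ x), fun j => hx2 (Sum.inl j), hx1, ?_⟩
  have hx3' : S (y x, w x) = x := hx3
  have h1 := hLs.dist_le_mul _ hx5 _ hx6
  rw [hx3', dist_comm, dist_eq_norm (u C₂ x)] at h1
  refine h1.trans ?_
  rw [mul_assoc]
  refine mul_le_mul_of_nonneg_left ((huv C₂ hC₂0 x).trans ?_) L.coe_nonneg
  change _ ≤ (C₁ + C₂ * ‖d‖) * R x
  linarith
end

open scoped Classical in
/-- The equality constraints of a branch, padded with zero functions. -/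
def branchEq {n p l : ℕ} (h : Fin p → Vec n → ℝ) (G H : Fin l → Vec n → ℝ) (S₃ S₄ : Set (Fin l)) :
    Fin p ⊕ Fin l ⊕ Fin l → Vec n → ℝ :=
  Sum.elim h (Sum.elim (fun k => if k ∈ S₃ then G k else 0) fun k => if k ∈ S₄ then H k else 0)

lemma gradient_zero_fun {n : ℕ} (x : Vec n) : gradient (0 : Vec n → ℝ) x = 0 :=
  gradient_fun_const x 0

lemma span_range_branchEq_union {n m p l : ℕ} (g : Fin m → Vec n → ℝ) (h : Fin p → Vec n → ℝ)
    (G H : Fin l → Vec n → ℝ) (I : Set (Fin m)) (S₃ S₄ : Set (Fin l)) (x : Vec n) :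
    Submodule.span ℝ ((range fun t => gradient (branchEq h G H S₃ S₄ t) x) ∪
        (fun i => gradient (g i) x) '' I) =
      Submodule.span ℝ ((fun i => gradient (g i) x) '' I ∪ range (fun j => gradient (h j) x) ∪
        (fun k => gradient (G k) x) '' S₃ ∪ (fun k => gradient (H k) x) '' S₄) := by
  apply le_antisymm <;> rw [Submodule.span_le]
  · rintro _ (⟨j | k | k, rfl⟩ | ⟨i, hi, rfl⟩)
    · exact Submodule.subset_span (Or.inl (Or.inl (Or.inr ⟨j, rfl⟩)))
    · by_cases hk : k ∈ S₃
      · exact Submodule.subset_span (Or.inl (Or.inr ⟨k, hk, by simp [branchEq, hk]⟩))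
      · simp [branchEq, hk, gradient_zero_fun]
    · by_cases hk : k ∈ S₄
      · exact Submodule.subset_span (Or.inr ⟨k, hk, by simp [branchEq, hk]⟩)
      · simp [branchEq, hk, gradient_zero_fun]
    · exact Submodule.subset_span (Or.inl (Or.inl (Or.inl ⟨i, hi, rfl⟩)))
  · rintro _ (((⟨i, hi, rfl⟩ | ⟨j, rfl⟩) | ⟨k, hk, rfl⟩) | ⟨k, hk, rfl⟩)
    · exact Submodule.subset_span (Or.inr ⟨i, hi, rfl⟩)
    · exact Submodule.subset_span (Or.inl ⟨Sum.inl j, rfl⟩)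
    · exact Submodule.subset_span (Or.inl ⟨Sum.inr (Sum.inl k), by simp [branchEq, hk]⟩)
    · exact Submodule.subset_span (Or.inl ⟨Sum.inr (Sum.inr k), by simp [branchEq, hk]⟩)

lemma sum_smul_gradient_branchEq {n p l : ℕ} (h : Fin p → Vec n → ℝ)
    (G H : Fin l → Vec n → ℝ) (S₃ S₄ : Set (Fin l)) (x : Vec n) (r : Fin p ⊕ Fin l ⊕ Fin l → ℝ)
    (μ ν : Fin l → ℝ) (hμ : ∀ k ∈ S₃, r (Sum.inr (Sum.inl k)) = μ k) (hμ' : ∀ k, k ∉ S₃ → μ k = 0)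
    (hν : ∀ k ∈ S₄, r (Sum.inr (Sum.inr k)) = ν k) (hν' : ∀ k, k ∉ S₄ → ν k = 0) :
    ∑ t, r t • gradient (branchEq h G H S₃ S₄ t) x =
      ∑ j, r (Sum.inl j) • gradient (h j) x + ∑ k, μ k • gradient (G k) x +
        ∑ k, ν k • gradient (H k) x := by
  rw [Fintype.sum_sum_type, Fintype.sum_sum_type, add_assoc]
  congr 2
  · refine Finset.sum_congr rfl fun k _ => ?_
    by_cases hk : k ∈ S₃
    · simp [branchEq, hk, hμ k hk]
    · simp [branchEq, hk, hμ' k hk, gradient_zero_fun]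
  · refine Finset.sum_congr rfl fun k _ => ?_
    by_cases hk : k ∈ S₄
    · simp [branchEq, hk, hν k hk]
    · simp [branchEq, hk, hν' k hk, gradient_zero_fun]

lemma mem_IgMinus_iff {n m p l : ℕ} (g : Fin m → Vec n → ℝ) (h : Fin p → Vec n → ℝ)
    (G H : Fin l → Vec n → ℝ) (xb : Vec n) (β₁ β₂ : Set (Fin l)) (i : Fin m) :
    i ∈ IgMinus g h G H xb β₁ β₂ ↔ HasPosRelation (fun i => gradient (g i) xb)
      (fun t => gradient (branchEq h G H (IG G H xb ∪ β₁) (IH G H xb ∪ β₂) t) xb)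
      {i | g i xb = 0} i := by
  classical
  constructor
  · rintro ⟨hi, lam, ρ, μ, ν, h1, h2, h3, h4, h5⟩
    have hs : ∀ k, (0 : ℝ) ≤ (Pi.single i 1 : Fin m → ℝ) k := fun k => by
      by_cases hk : k = i
      · subst hk; simp
      · simp [hk]
    refine ⟨lam + Pi.single i 1, Sum.elim ρ (Sum.elim μ ν), fun k => add_nonneg (h1 k) (hs k),
      fun k hk => ?_, ?_, ?_⟩
    · have : k ≠ i := by rintro rfl; exact hk hi
      simp [this, h2 k fun h => hk h.1]
    · have := h1 i
      simp only [Pi.add_apply, Pi.single_eq_same]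
      positivity
    · rw [sum_smul_gradient_branchEq (μ := μ) (ν := ν) (hμ' := h3) (hν' := h4) (hμ := fun _ _ => rfl)
        (hν := fun _ _ => rfl)]
      have h6 : ∑ k, (Pi.single i 1 : Fin m → ℝ) k • gradient (g k) xb = gradient (g i) xb := by
        simp [Pi.single_apply]
      simp only [Pi.add_apply, add_smul, Finset.sum_add_distrib, h6, Sum.elim_inl]
      have h7 : gradient (g i) xb + (∑ i', lam i' • gradient (g i') xb +
          ∑ j, ρ j • gradient (h j) xb + ∑ k, μ k • gradient (G k) xb +
          ∑ k, ν k • gradient (H k) xb) = 0 := by rw [← h5, add_neg_cancel]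
      rw [← h7]
      abel
  · rintro ⟨c, r, h1, h2, h3, h4⟩
    have hi : i ∈ Ig g xb := by
      by_contra hne
      exact h3.ne' (h2 i hne)
    let μ : Fin l → ℝ := fun k => if k ∈ IG G H xb ∪ β₁ then r (Sum.inr (Sum.inl k)) else 0
    let ν : Fin l → ℝ := fun k => if k ∈ IH G H xb ∪ β₂ then r (Sum.inr (Sum.inr k)) else 0
    refine ⟨hi, fun k => (c i)⁻¹ * (if k = i then 0 else c k), fun j => (c i)⁻¹ * r (Sum.inl j),
      fun k => (c i)⁻¹ * μ k, fun k => (c i)⁻¹ * ν k, fun k => ?_, fun k hk => ?_, fun k hk => ?_,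
      fun k hk => ?_, ?_⟩
    · have := h1 k
      dsimp only
      split_ifs <;> positivity
    · by_cases hki : k = i
      · simp [hki]
      · simp [hki, h2 k fun h => hk ⟨h, hki⟩]
    · exact mul_eq_zero_of_right _ (if_neg hk)
    · exact mul_eq_zero_of_right _ (if_neg hk)
    · rw [sum_smul_gradient_branchEq (μ := μ) (ν := ν) (hμ := fun k hk => (if_pos hk).symm)
        (hν := fun k hk => (if_pos hk).symm) (hμ' := fun k hk => if_neg hk)
        (hν' := fun k hk => if_neg hk)] at h4
      simp only [mul_smul, ← Finset.smul_sum, ← smul_add]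
      rw [eq_inv_smul_iff₀ h3.ne']
      have h5 : ∑ k, c k • gradient (g k) xb = c i • gradient (g i) xb +
          ∑ k, (if k = i then 0 else c k) • gradient (g k) xb := by
        rw [← Finset.add_sum_erase _ _ (Finset.mem_univ i),
          ← Finset.add_sum_erase _ (fun k => (if k = i then (0 : ℝ) else c k) • gradient (g k) xb)
            (Finset.mem_univ i)]
        simp only [if_true, zero_smul, zero_add]
        congr 1
        refine Finset.sum_congr rfl fun k hk => ?_
        rw [if_neg (Finset.ne_of_mem_erase hk)]
      rw [h5] at h4
      rw [smul_neg, ← sub_eq_zero, ← neg_eq_zero, ← h4]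
      abel

/-- For each partition of the biactive set, the distance to the feasible set is bounded by the
residual of the corresponding branch problem. -/
lemma branch_error_bound {n m p l : ℕ} {g : Fin m → Vec n → ℝ}
    {h : Fin p → Vec n → ℝ} {G H : Fin l → Vec n → ℝ}
    (hg : ∀ i, ContDiff ℝ 1 (g i)) (hh : ∀ j, ContDiff ℝ 1 (h j))
    (hG : ∀ k, ContDiff ℝ 1 (G k)) (hH : ∀ k, ContDiff ℝ 1 (H k))
    {xb : Vec n} (hxb : xb ∈ Feas g h G H) (hcq : PCRSC g h G H xb)
    {β₁ β₂ : Set (Fin l)} (hβ : Partition G H xb β₁ β₂) :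
    ∃ C : ℝ, ∀ᶠ x in 𝓝 xb, ∃ z ∈ Feas g h G H,
      dist x z ≤ C * (∑ t, |branchEq h G H (IG G H xb ∪ β₁) (IH G H xb ∪ β₂) t x| +
        ∑ i, max (g i x) 0) := by
  classical
  obtain ⟨hg₀, hh₀, hGH₀⟩ := hxb
  have hS₃ : ∀ k ∈ IG G H xb ∪ β₁, G k xb = 0 := by
    rintro k (hk | hk)
    · exact hk.1
    · exact (hβ.2 ▸ mem_union_left β₂ hk : k ∈ IGH G H xb).1
  have hS₄ : ∀ k ∈ IH G H xb ∪ β₂, H k xb = 0 := by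
    rintro k (hk | hk)
    · exact hk.2
    · exact (hβ.2 ▸ mem_union_right β₁ hk : k ∈ IGH G H xb).2
  have hcover : ∀ k, k ∈ IG G H xb ∪ β₁ ∨ k ∈ IH G H xb ∪ β₂ := by
    intro k
    by_cases hGk : G k xb = 0
    · by_cases hHk : H k xb = 0
      · have : k ∈ β₁ ∪ β₂ := hβ.2 ▸ (⟨hGk, hHk⟩ : k ∈ IGH G H xb)
        exact this.imp (mem_union_right _) (mem_union_right _)
      · exact Or.inl (Or.inl ⟨hGk, hHk⟩)
    · exact Or.inr (Or.inl ⟨hGk, (mul_eq_zero.1 (hGH₀ k)).resolve_left hGk⟩)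
  set S₃ := IG G H xb ∪ β₁
  set S₄ := IH G H xb ∪ β₂
  have he : ∀ t, ContDiff ℝ 1 (branchEq h G H S₃ S₄ t) := by
    have hz : ContDiff ℝ 1 (0 : Vec n → ℝ) := contDiff_const
    rintro (j | k | k)
    · exact hh j
    · by_cases hk : k ∈ S₃
      · simpa [branchEq, hk] using hG k
      · simp only [branchEq, Sum.elim_inr, Sum.elim_inl, if_neg hk]
        exact hz
    · by_cases hk : k ∈ S₄
      · simpa [branchEq, hk] using hH k
      · simp only [branchEq, Sum.elim_inr, if_neg hk]
        exact hz
  have he₀ : ∀ t, branchEq h G H S₃ S₄ t xb = 0 := by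
    rintro (j | k | k)
    · exact hh₀ j
    · by_cases hk : k ∈ S₃
      · simpa [branchEq, hk] using hS₃ k hk
      · simp [branchEq, hk]
    · by_cases hk : k ∈ S₄
      · simpa [branchEq, hk] using hS₄ k hk
      · simp [branchEq, hk]
  obtain ⟨ε, hε, hrank⟩ := hcq β₁ β₂ hβ
  obtain ⟨C, hC⟩ := error_bound_of_constant_rank he hg he₀ hg₀
    (mem_IgMinus_iff g h G H xb β₁ β₂) (by
      filter_upwards [Metric.ball_mem_nhds xb hε] with x hx
      have := hrank x (by rwa [mem_ball, dist_eq_norm] at hx)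
      rw [span_range_branchEq_union, span_range_branchEq_union]
      exact this)
  refine ⟨C, hC.mono fun x ⟨z, hez, hgz, hd⟩ => ⟨z, ⟨hgz, fun j => hez (Sum.inl j), fun k => ?_⟩, hd⟩⟩
  rcases hcover k with hk | hk
  · have := hez (Sum.inr (Sum.inl k))
    simp only [branchEq, Sum.elim_inr, Sum.elim_inl, if_pos hk] at this
    rw [this, zero_mul]
  · have := hez (Sum.inr (Sum.inr k))
    simp only [branchEq, Sum.elim_inr, if_pos hk] at this
    rw [this, mul_zero]

lemma branch_residual_le {n m p l : ℕ} {g : Fin m → Vec n → ℝ}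
    {h : Fin p → Vec n → ℝ} {G H : Fin l → Vec n → ℝ} {S₃ S₄ : Set (Fin l)} {x : Vec n}
    (hS₃ : ∀ k ∈ S₃, G k x ^ 2 ≤ H k x ^ 2) (hS₄ : ∀ k ∈ S₄, H k x ^ 2 ≤ G k x ^ 2) :
    ∑ t, |branchEq h G H S₃ S₄ t x| + ∑ i, max (g i x) 0 ≤
      (p + 2 * l + m) * residual g h G H x := by
  have h1 : ∀ i, max (g i x) 0 ^ 2 ≤ ∑ i, max (g i x) 0 ^ 2 := fun i =>
    Finset.single_le_sum (f := fun i => max (g i x) 0 ^ 2) (fun k _ => sq_nonneg _)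
      (Finset.mem_univ i)
  have h2 : ∀ j, h j x ^ 2 ≤ ∑ j, h j x ^ 2 := fun j =>
    Finset.single_le_sum (f := fun j => h j x ^ 2) (fun k _ => sq_nonneg _) (Finset.mem_univ j)
  have h3 : ∀ k, min (G k x ^ 2) (H k x ^ 2) ≤ ∑ k, min (G k x ^ 2) (H k x ^ 2) := fun k =>
    Finset.single_le_sum (f := fun k => min (G k x ^ 2) (H k x ^ 2))
      (fun k _ => le_min (sq_nonneg _) (sq_nonneg _)) (Finset.mem_univ k)
  have h1' : 0 ≤ ∑ i, max (g i x) 0 ^ 2 := Finset.sum_nonneg fun i _ => sq_nonneg _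
  have h2' : 0 ≤ ∑ j, h j x ^ 2 := Finset.sum_nonneg fun i _ => sq_nonneg _
  have h3' : 0 ≤ ∑ k, min (G k x ^ 2) (H k x ^ 2) :=
    Finset.sum_nonneg fun k _ => le_min (sq_nonneg _) (sq_nonneg _)
  have hres : 0 ≤ residual g h G H x := Real.sqrt_nonneg _
  have he : ∀ t, |branchEq h G H S₃ S₄ t x| ≤ residual g h G H x := by
    rintro (j | k | k)
    · refine Real.abs_le_sqrt ?_
      change h j x ^ 2 ≤ _
      linarith [h2 j]
    · by_cases hk : k ∈ S₃
      · simp only [branchEq, Sum.elim_inr, Sum.elim_inl, if_pos hk]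
        refine Real.abs_le_sqrt ?_
        have := h3 k
        rw [min_eq_left (hS₃ k hk)] at this
        linarith
      · simpa [branchEq, hk] using hres
    · by_cases hk : k ∈ S₄
      · simp only [branchEq, Sum.elim_inr, if_pos hk]
        refine Real.abs_le_sqrt ?_
        have := h3 k
        rw [min_eq_right (hS₄ k hk)] at this
        linarith
      · simpa [branchEq, hk] using hres
  have hg : ∀ i, max (g i x) 0 ≤ residual g h G H x := fun i =>
    Real.le_sqrt_of_sq_le (by linarith [h1 i])
  have h4 := Finset.sum_le_card_nsmul Finset.univ _ _ fun t _ => he t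
  have h5 := Finset.sum_le_card_nsmul Finset.univ _ _ fun i _ => hg i
  simp only [Finset.card_univ, Fintype.card_sum, Fintype.card_fin, nsmul_eq_mul, Nat.cast_add]
    at h4 h5
  linarith

theorem pcrsc_implies_error_bound {n m p l : ℕ} (f : Vec n → ℝ) (g : Fin m → Vec n → ℝ)
    (h : Fin p → Vec n → ℝ) (G H : Fin l → Vec n → ℝ)
    (hf : ContDiff ℝ 2 f) (hg : ∀ i, ContDiff ℝ 2 (g i)) (hh : ∀ j, ContDiff ℝ 2 (h j))
    (hG : ∀ k, ContDiff ℝ 2 (G k)) (hH : ∀ k, ContDiff ℝ 2 (H k))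
    (xb : Vec n) (hxb : xb ∈ Feas g h G H)
    (hcq : PCRSC g h G H xb) :
    ∃ ε > (0:ℝ), ∃ α > (0:ℝ), ∀ x : Vec n, ‖x - xb‖ < ε →
      Metric.infDist x (Feas g h G H) ≤ α * residual g h G H x := by
  have h12 : (1 : WithTop ℕ∞) ≤ 2 := one_le_two
  have hbranch : ∀ β₁ : Set (Fin l), ∃ C : ℝ, β₁ ⊆ IGH G H xb →
      ∀ᶠ x in 𝓝 xb, ∃ z ∈ Feas g h G H, dist x z ≤
        C * (∑ t, |branchEq h G H (IG G H xb ∪ β₁) (IH G H xb ∪ IGH G H xb \ β₁) t x| +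
          ∑ i, max (g i x) 0) := by
    intro β₁
    by_cases hβ : β₁ ⊆ IGH G H xb
    · obtain ⟨C, hC⟩ := branch_error_bound (fun i => (hg i).of_le h12) (fun j => (hh j).of_le h12)
        (fun k => (hG k).of_le h12) (fun k => (hH k).of_le h12) hxb hcq
        (⟨inter_sdiff_self _ _, union_sdiff_cancel hβ⟩ :
          Partition G H xb β₁ (IGH G H xb \ β₁))
      exact ⟨C, fun _ => hC⟩
    · exact ⟨0, fun h => (hβ h).elim⟩
  choose C hC using hbranch
  have hall : ∀ᶠ x in 𝓝 xb, ∀ β₁ : Set (Fin l), β₁ ⊆ IGH G H xb →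
      ∃ z ∈ Feas g h G H, dist x z ≤
        C β₁ * (∑ t, |branchEq h G H (IG G H xb ∪ β₁) (IH G H xb ∪ IGH G H xb \ β₁) t x| +
          ∑ i, max (g i x) 0) :=
    eventually_all.2 fun β₁ => eventually_imp_distrib_left.2 (hC β₁)
  have hIG : ∀ᶠ x in 𝓝 xb, ∀ k, k ∈ IG G H xb → G k x ^ 2 ≤ H k x ^ 2 := by
    refine eventually_all.2 fun k => eventually_imp_distrib_left.2 fun hk => ?_
    have hlt : G k xb ^ 2 < H k xb ^ 2 := by
      rw [hk.1, zero_pow two_ne_zero]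
      exact sq_pos_of_ne_zero hk.2
    exact (((hG k).continuous.pow 2).continuousAt.eventually_lt
      ((hH k).continuous.pow 2).continuousAt hlt).mono fun x hx => hx.le
  have hIH : ∀ᶠ x in 𝓝 xb, ∀ k, k ∈ IH G H xb → H k x ^ 2 ≤ G k x ^ 2 := by
    refine eventually_all.2 fun k => eventually_imp_distrib_left.2 fun hk => ?_
    have hlt : H k xb ^ 2 < G k xb ^ 2 := by
      rw [hk.2, zero_pow two_ne_zero]
      exact sq_pos_of_ne_zero hk.1
    exact (((hH k).continuous.pow 2).continuousAt.eventually_lt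
      ((hG k).continuous.pow 2).continuousAt hlt).mono fun x hx => hx.le
  obtain ⟨ε, hε, hball⟩ := Metric.eventually_nhds_iff.1 (hall.and (hIG.and hIH))
  have : Fintype (Set (Fin l)) := Fintype.ofFinite _
  have hCnn : 0 ≤ ∑ β, |C β| := Finset.sum_nonneg fun _ _ => abs_nonneg _
  refine ⟨ε, hε, (∑ β, |C β|) * (p + 2 * l + m) + 1, by positivity, fun x hx => ?_⟩
  obtain ⟨hx1, hx2, hx3⟩ := hball (by rwa [dist_eq_norm])
  set β₁ : Set (Fin l) := {k | k ∈ IGH G H xb ∧ G k x ^ 2 ≤ H k x ^ 2} with hβ₁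
  obtain ⟨z, hz, hxz⟩ := hx1 β₁ fun k hk => hk.1
  have hle := branch_residual_le (g := g) (h := h) (G := G) (H := H) (x := x)
    (S₃ := IG G H xb ∪ β₁) (S₄ := IH G H xb ∪ IGH G H xb \ β₁)
    (fun k hk => hk.elim (hx2 k) fun hk => hk.2)
    (fun k hk => hk.elim (hx3 k) fun hk => (not_le.1 fun h => hk.2 ⟨hk.1, h⟩).le)
  have hres : 0 ≤ residual g h G H x := Real.sqrt_nonneg _
  refine (Metric.infDist_le_dist_of_mem hz).trans (hxz.trans ?_)
  have hCβ : C β₁ ≤ ∑ β, |C β| := (le_abs_self _).trans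
    (Finset.single_le_sum (f := fun β => |C β|) (fun _ _ => abs_nonneg _) (Finset.mem_univ β₁))
  have hsum : 0 ≤ ∑ t, |branchEq h G H (IG G H xb ∪ β₁) (IH G H xb ∪ IGH G H xb \ β₁) t x| +
      ∑ i, max (g i x) 0 := by positivity
  calc _ ≤ (∑ β, |C β|) * ((p + 2 * l + m) * residual g h G H x) := by gcongr
    _ ≤ _ := by linarith

end MPSC
end
end

section
/- Let x̄ ∈ F be a locally optimal solution of (MPSC) and assume that MPSC-PWCR and MPSC-PSOQN hold at x̄. Then the penalty problem admits a local exact penalization at x̄: there exists κ̄ > 0 such that for every κ > κ̄, x̄ is a local minimizer of the penalty function P_κ, i.e., there exists ε' > 0 with P_κ(x̄) ≤ P_κ(x) for all x with ‖x − x̄‖ < ε'. -/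
open Set Filter Topology Metric

noncomputable section

namespace MPSC

variable {n m p l : ℕ}

section ConstantRank

variable {E : Type*} [NormedAddCommGroup E] [InnerProductSpace ℝ E] {ι : Type*} [Fintype ι]

/-- Near a linearly independent family, coefficients are controlled by the norm of the
linear combination. -/
lemma _root_.LinearIndependent.exists_eventually_abs_coeff_le {w : ι → E}
    (hw : LinearIndependent ℝ w) :
    ∃ K : ℝ, 0 ≤ K ∧
      ∀ᶠ v in 𝓝 w, ∀ a : ι → ℝ, ∀ i, |a i| ≤ K * ‖∑ j, a j • v j‖ := by
  obtain ⟨K, hK, hlip⟩ := LinearMap.exists_antilipschitzWith (Fintype.linearCombination ℝ w)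
    (LinearMap.ker_eq_bot.2 hw.fintypeLinearCombination_injective)
  have hK' : (0 : ℝ) < K := hK
  refine ⟨2 * K, by positivity, ?_⟩
  have hlim : Tendsto (fun v : ι → E => ∑ j, ‖w j - v j‖) (𝓝 w) (𝓝 (∑ j, ‖w j - w j‖)) :=
    tendsto_finsetSum _ fun i _ =>
      Tendsto.norm (tendsto_const_nhds.sub ((continuous_apply i).tendsto _))
  simp only [sub_self, norm_zero, Finset.sum_const_zero] at hlim
  filter_upwards [hlim.eventually_lt_const (show (0 : ℝ) < 1 / (2 * K) by positivity)]
    with v hv a i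
  have hbound : ‖a‖ ≤ K * ‖∑ j, a j • w j‖ := by
    simpa [Fintype.linearCombination_apply] using
      (hlip.le_mul_norm_sub (x := a) (y := 0))
  have hpert : ‖∑ j, a j • w j‖ ≤ ‖∑ j, a j • v j‖ + ‖a‖ * ∑ j, ‖w j - v j‖ := by
    have hsplit : ∑ j, a j • w j = ∑ j, a j • v j + ∑ j, a j • (w j - v j) := by
      rw [← Finset.sum_add_distrib]
      exact Finset.sum_congr rfl fun j _ => by rw [← smul_add]; congr 1; abel
    rw [hsplit]
    refine (norm_add_le _ _).trans (add_le_add le_rfl ?_)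
    rw [Finset.mul_sum]
    refine (norm_sum_le _ _).trans (Finset.sum_le_sum fun j _ => ?_)
    rw [norm_smul]
    exact mul_le_mul_of_nonneg_right (norm_le_pi_norm a j) (norm_nonneg _)
  have hhalf : K * (‖a‖ * ∑ j, ‖w j - v j‖) ≤ ‖a‖ / 2 := by
    have := mul_le_mul_of_nonneg_left hv.le (show 0 ≤ K * ‖a‖ by positivity)
    calc _ = K * ‖a‖ * ∑ j, ‖w j - v j‖ := by ring
      _ ≤ _ := this
      _ = _ := by field_simp
  have hi : |a i| ≤ ‖a‖ := norm_le_pi_norm a i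
  have := mul_le_mul_of_nonneg_left hpert hK'.le
  linarith [mul_add (K : ℝ) ‖∑ j, a j • v j‖ (‖a‖ * ∑ j, ‖w j - v j‖)]

/-- If a family of vector fields has constant rank near `x`, then a linear relation between the
fields at `x` annihilates the associated quadratic form on the orthogonal complement of the
family. -/
lemma sum_inner_eq_zero_of_constant_rank [FiniteDimensional ℝ E]
    {v : ι → E → E} {D : ι → E →L[ℝ] E} {x : E}
    (hD : ∀ i, HasFDerivAt (v i) (D i) x) {T : Set ι}
    (hrank : ∀ᶠ y in 𝓝 x, Module.finrank ℝ (Submodule.span ℝ ((fun i => v i y) '' T)) =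
      Module.finrank ℝ (Submodule.span ℝ ((fun i => v i x) '' T)))
    {c : ι → ℝ} (hcT : ∀ i ∉ T, c i = 0) (hc : ∑ i, c i • v i x = 0)
    {d : E} (hd : ∀ i ∈ T, inner ℝ (v i x) d = 0) :
    ∑ i, c i * inner ℝ (D i d) d = 0 := by
  classical
  obtain ⟨B, hBT, -, hspan, hB⟩ := exists_linearIndepOn_extension (K := ℝ)
    (v := fun i => v i x) (linearIndepOn_empty ℝ _) (Set.empty_subset T)
  have hB' : LinearIndependent ℝ (fun i : B => v i x) := hB
  obtain ⟨K, hK0, hK⟩ := hB'.exists_eventually_abs_coeff_le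
  have hcont : Tendsto (fun y => fun i : B => v i y) (𝓝 x) (𝓝 fun i : B => v i x) :=
    tendsto_pi_nhds.2 fun i => (hD i).continuousAt
  have hmem : ∀ᶠ y in 𝓝 x, ∀ i ∈ T,
      v i y ∈ Submodule.span ℝ (Set.range fun j : B => v j y) := by
    filter_upwards [hrank, hcont.eventually hB'.eventually] with y hy hind i hi
    have hle : Submodule.span ℝ (Set.range fun j : B => v j y) ≤
        Submodule.span ℝ ((fun i => v i y) '' T) := by
      refine Submodule.span_mono ?_
      rintro _ ⟨j, rfl⟩
      exact ⟨j, hBT j.2, rfl⟩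
    have hx : Submodule.span ℝ ((fun i => v i x) '' T) =
        Submodule.span ℝ (Set.range fun j : B => v j x) := by
      rw [← Set.image_eq_range (fun i => v i x) B]
      exact le_antisymm (Submodule.span_le.2 hspan) (Submodule.span_mono (Set.image_mono hBT))
    have hfin := Submodule.eq_of_le_of_finrank_eq hle (by
      rw [hy, hx, finrank_span_eq_card hind, finrank_span_eq_card hB'])
    rw [hfin]
    exact Submodule.subset_span ⟨i, hi, rfl⟩
  set ψ : E → E := fun y => ∑ i, c i • v i y with hψ
  have hψx : Tendsto ψ (𝓝 x) (𝓝 0) := by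
    rw [← hc]
    exact tendsto_finsetSum _ fun i _ => (hD i).continuousAt.tendsto.const_smul (c i)
  have hest : ∀ᶠ y in 𝓝 x, |inner ℝ (ψ y) d| ≤
      K * ‖ψ y‖ * ∑ j : B, |inner ℝ (v j y) d| := by
    filter_upwards [hmem, hcont.eventually hK] with y hy hKy
    have hψmem : ψ y ∈ Submodule.span ℝ (Set.range fun j : B => v j y) := by
      refine Submodule.sum_mem _ fun i _ => ?_
      by_cases hi : i ∈ T
      · exact Submodule.smul_mem _ _ (hy i hi)
      · simp [hcT i hi]
    obtain ⟨a, ha⟩ := (Submodule.mem_span_range_iff_exists_fun ℝ).1 hψmem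
    rw [Finset.mul_sum]
    calc |inner ℝ (ψ y) d| = |∑ j, a j * inner ℝ (v j y) d| := by
          rw [← ha, sum_inner]; simp [inner_smul_left]
      _ ≤ ∑ j, |a j * inner ℝ (v j y) d| := Finset.abs_sum_le_sum_abs _ _
      _ ≤ _ := Finset.sum_le_sum fun j _ => by
          rw [abs_mul, ← ha]
          exact mul_le_mul_of_nonneg_right (hKy a j) (abs_nonneg _)
  have hline : Tendsto (fun t : ℝ => x + t • d) (𝓝[≠] 0) (𝓝 x) := by
    have : Continuous fun t : ℝ => x + t • d := by fun_prop
    simpa using (this.tendsto 0).mono_left nhdsWithin_le_nhds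
  have hslope : ∀ i ∈ T, Tendsto (fun t : ℝ => t⁻¹ * inner ℝ (v i (x + t • d)) d) (𝓝[≠] 0)
      (𝓝 (inner ℝ (D i d) d)) := by
    intro i hi
    have h1 : HasDerivAt (fun t : ℝ => v i (x + t • d)) (D i d) 0 := (hD i).hasLineDerivAt d
    have h2 := (hasDerivAt_iff_tendsto_slope_zero.1 h1).inner (𝕜 := ℝ) (tendsto_const_nhds (x := d))
    refine h2.congr fun t => ?_
    simp [inner_smul_left, inner_sub_left, hd i hi]
  have hlim : Tendsto (fun t : ℝ => |∑ i, c i * (t⁻¹ * inner ℝ (v i (x + t • d)) d)|) (𝓝[≠] 0)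
      (𝓝 |∑ i, c i * inner ℝ (D i d) d|) := by
    refine Tendsto.abs (tendsto_finsetSum _ fun i _ => ?_)
    by_cases hi : i ∈ T
    · exact (hslope i hi).const_mul _
    · simp [hcT i hi]
  have hlim0 : Tendsto (fun t : ℝ => K * ‖ψ (x + t • d)‖ *
      ∑ j : B, |t⁻¹ * inner ℝ (v j (x + t • d)) d|) (𝓝[≠] 0)
      (𝓝 (K * ‖(0 : E)‖ * ∑ j : B, |inner ℝ (D j d) d|)) :=
    ((hψx.comp hline).norm.const_mul K).mul
      (tendsto_finsetSum _ fun j _ => (hslope j (hBT j.2)).abs)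
  have hle := le_of_tendsto_of_tendsto hlim hlim0 (by
    filter_upwards [hline.eventually hest] with t ht
    have hsum : ∑ i, c i * (t⁻¹ * inner ℝ (v i (x + t • d)) d) =
        t⁻¹ * inner ℝ (ψ (x + t • d)) d := by
      rw [hψ, sum_inner, Finset.mul_sum]
      exact Finset.sum_congr rfl fun i _ => by rw [real_inner_smul_left]; ring
    rw [hsum, abs_mul]
    simp_rw [abs_mul t⁻¹, ← Finset.mul_sum]
    calc _ ≤ |t⁻¹| * _ := mul_le_mul_of_nonneg_left ht (abs_nonneg _)
      _ = _ := by ring)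
  simpa using hle

end ConstantRank

section SmoothPenalty

variable {E : Type*} [NormedAddCommGroup E] [InnerProductSpace ℝ E]

/-- A smooth variational principle: a positive continuous function on a closed ball of radius
`δ / 2` about `x` has a point in the ball at which every smooth majorant of its square that
touches there has a gradient controlled by the value at `x`. -/
lemma exists_touching_fderiv_le [ProperSpace E] {R : E → ℝ} (hR : Continuous R) {x : E} {δ : ℝ}
    (hδ : 0 < δ) (hpos : ∀ y ∈ closedBall x (δ / 2), 0 < R y) :
    ∃ u ∈ ball x (δ / 2), ∀ (Q : E → ℝ) (Q' : E →L[ℝ] ℝ), HasFDerivAt Q Q' u →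
      (∀ y, R y ^ 2 ≤ Q y) → Q u = R u ^ 2 → ‖Q'‖ ≤ 2 * R u * (8 * R x / δ) := by
  have hx : 0 < R x := hpos x (mem_closedBall_self (by positivity))
  set c := 8 * R x / δ ^ 2 with hc
  have hc0 : 0 < c := by positivity
  obtain ⟨u, hu, hmin⟩ := (isCompact_closedBall x (δ / 2)).exists_isMinOn
    ⟨x, mem_closedBall_self (by positivity)⟩
    (show ContinuousOn (fun y => R y + c * ‖y - x‖ ^ 2) (closedBall x (δ / 2)) by fun_prop)
  have hux : R u + c * ‖u - x‖ ^ 2 ≤ R x := by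
    simpa using hmin (mem_closedBall_self (by positivity : 0 ≤ δ / 2))
  have hRu : 0 < R u := hpos u hu
  have hball : u ∈ ball x (δ / 2) := by
    rw [mem_ball, dist_eq_norm]
    by_contra! hge
    have h1 : (δ / 2) ^ 2 ≤ ‖u - x‖ ^ 2 := pow_le_pow_left₀ (by positivity) hge 2
    have h2 := mul_le_mul_of_nonneg_left h1 hc0.le
    have h3 : c * (δ / 2) ^ 2 = 2 * R x := by rw [hc]; field_simp; ring
    linarith
  refine ⟨u, hball, fun Q Q' hQ hle heq => ?_⟩
  have hQu : Q u ≠ 0 := by rw [heq]; positivity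
  have hsq : √(Q u) = R u := by rw [heq, Real.sqrt_sq hRu.le]
  have hder := (hQ.sqrt hQu).add
    (((hasStrictFDerivAt_norm_sq (u - x)).hasFDerivAt.comp u
      ((hasFDerivAt_id u).sub_const x)).const_mul c)
  have hloc : IsLocalMin ((fun y => √(Q y)) + fun y => c * ‖y - x‖ ^ 2) u := by
    filter_upwards [isOpen_ball.mem_nhds hball] with y hy
    have h1 := hmin (ball_subset_closedBall hy)
    have h2 : R y ≤ √(Q y) := Real.le_sqrt_of_sq_le (hle y)
    simp only [Pi.add_apply, hsq] at h1 ⊢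
    simp only [Set.mem_ofPred_eq] at h1
    linarith
  have hzero := hloc.hasFDerivAt_eq_zero hder
  rw [hsq] at hzero
  have hQ' : Q' = -((2 * R u) • (c • (2 • innerSL ℝ (u - x)))) := by
    ext y
    have hy := congrArg (fun L : E →L[ℝ] ℝ => L y) hzero
    simp at hy ⊢
    field_simp at hy
    linarith
  have hnorm : ‖u - x‖ ≤ δ / 2 := by simpa [dist_eq_norm] using hu
  rw [hQ', norm_neg, norm_smul, norm_smul, Real.norm_of_nonneg (by positivity : 0 ≤ 2 * R u),
    Real.norm_of_nonneg hc0.le, two_smul, ← two_smul ℝ, norm_smul, innerSL_apply_norm,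
    Real.norm_of_nonneg zero_le_two]
  refine mul_le_mul_of_nonneg_left ?_ (by positivity)
  calc c * (2 * ‖u - x‖) ≤ c * (2 * (δ / 2)) := by gcongr
    _ = _ := by rw [hc]; field_simp

/-- Normalized constraint values along an ultrafilter converge to a nontrivial multiplier vector
with vanishing gradient combination. -/
lemma exists_limit_multipliers {ι : Type*} [Fintype ι] {φ : ι → E → ℝ}
    (hφ : ∀ i, ContDiff ℝ 1 (φ i)) {θ : ι → ℝ → ℝ}
    (hθ : ∀ i a t, 0 < a * θ i t → 0 < a * t)
    {α : Type*} {U : Ultrafilter α} {u : α → E} {x : E} (hu : Tendsto u U (𝓝 x))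
    {r η : α → ℝ} (hr : ∀ᶠ k in U, 0 < r k)
    (hr2 : ∀ᶠ k in U, ∑ i, θ i (φ i (u k)) ^ 2 = r k ^ 2)
    (hη : Tendsto η U (𝓝 0))
    (hder : ∀ᶠ k in U, ‖∑ i, (2 * θ i (φ i (u k))) • fderiv ℝ (φ i) (u k)‖ ≤ 2 * r k * η k) :
    ∃ Λ : ι → ℝ, (∑ i, Λ i ^ 2 = 1) ∧ (∑ i, Λ i • fderiv ℝ (φ i) x = 0) ∧
      (∀ i, Tendsto (fun k => θ i (φ i (u k)) / r k) U (𝓝 (Λ i))) ∧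
      ∀ i, Λ i ≠ 0 → ∀ᶠ k in U, 0 < Λ i * φ i (u k) := by
  have hsq : ∀ᶠ k in U, ∑ i, (θ i (φ i (u k)) / r k) ^ 2 = 1 := by
    filter_upwards [hr, hr2] with k hk hk2
    simp_rw [div_pow]
    rw [← Finset.sum_div, hk2, div_self (by positivity)]
  have hex : ∀ i, ∃ a : ℝ, Tendsto (fun k => θ i (φ i (u k)) / r k) U (𝓝 a) := by
    intro i
    obtain ⟨a, -, ha⟩ := (isCompact_Icc (a := (-1 : ℝ)) (b := 1)).ultrafilter_le_nhds'
      (U.map fun k => θ i (φ i (u k)) / r k) (by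
        rw [Ultrafilter.mem_map, ← Ultrafilter.mem_coe]
        filter_upwards [hsq] with k hk
        have : (θ i (φ i (u k)) / r k) ^ 2 ≤ 1 := by
          rw [← hk]
          exact Finset.single_le_sum (f := fun i => (θ i (φ i (u k)) / r k) ^ 2)
            (fun _ _ => sq_nonneg _) (Finset.mem_univ i)
        exact abs_le.1 (abs_le_one_iff_mul_self_le_one.2 (by rwa [← sq])))
    exact ⟨a, ha⟩
  choose Λ hΛ using hex
  refine ⟨Λ, ?_, ?_, hΛ, fun i hi => ?_⟩
  · exact tendsto_nhds_unique ((tendsto_finsetSum _ fun i _ => (hΛ i).pow 2).congr' hsq)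
      tendsto_const_nhds
  · have hlim : Tendsto (fun k => ∑ i, (θ i (φ i (u k)) / r k) • fderiv ℝ (φ i) (u k)) U
        (𝓝 (∑ i, Λ i • fderiv ℝ (φ i) x)) :=
      tendsto_finsetSum _ fun i _ => (hΛ i).smul
        ((((hφ i).continuous_fderiv one_ne_zero).tendsto x).comp hu)
    refine tendsto_nhds_unique hlim (squeeze_zero_norm' ?_ hη)
    filter_upwards [hr, hder] with k hk hd
    have : ∑ i, (2 * θ i (φ i (u k))) • fderiv ℝ (φ i) (u k) =
        (2 * r k) • ∑ i, (θ i (φ i (u k)) / r k) • fderiv ℝ (φ i) (u k) := by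
      rw [Finset.smul_sum]
      refine Finset.sum_congr rfl fun i _ => ?_
      rw [smul_smul]
      congr 1
      field_simp
    rw [this, norm_smul, Real.norm_of_nonneg (by positivity)] at hd
    exact le_of_mul_le_mul_left hd (by positivity)
  · have hpos : 0 < Λ i * Λ i := mul_self_pos.2 hi
    filter_upwards [hr, ((hΛ i).const_mul (Λ i)).eventually_const_lt hpos] with k hk h
    refine hθ i _ _ ?_
    have := mul_pos h hk
    rwa [mul_assoc, div_mul_cancel₀ _ hk.ne'] at this

end SmoothPenalty

lemma hasDerivAt_max_zero_sq (t : ℝ) :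
    HasDerivAt (fun s : ℝ => max s 0 ^ 2) (2 * max t 0) t := by
  rcases lt_trichotomy t 0 with ht | rfl | ht
  · have : (fun s : ℝ => max s 0 ^ 2) =ᶠ[𝓝 t] fun _ => 0 := by
      filter_upwards [Iio_mem_nhds ht] with s hs
      simp [max_eq_right (mem_Iio.1 hs).le]
    simpa [max_eq_right ht.le] using (hasDerivAt_const t (0 : ℝ)).congr_of_eventuallyEq this
  · rw [hasDerivAt_iff_isLittleO]
    have : (fun s : ℝ => s ^ 2) =o[𝓝 0] fun s => s := by
      simpa using Asymptotics.isLittleO_pow_id (𝕜 := ℝ) (n := 2) (by norm_num)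
    simp only [max_self, sub_zero, mul_zero, smul_zero, ne_eq, OfNat.ofNat_ne_zero,
      not_false_eq_true, zero_pow]
    refine Asymptotics.IsBigO.trans_isLittleO (.of_bound 1 (.of_forall fun s => ?_)) this
    rcases le_total s 0 with hs | hs <;> simp [hs, sq_nonneg]
  · have : (fun s : ℝ => max s 0 ^ 2) =ᶠ[𝓝 t] fun s => s ^ 2 := by
      filter_upwards [Ioi_mem_nhds ht] with s hs
      rw [max_eq_left (mem_Ioi.1 hs).le]
    simpa [max_eq_left ht.le] using (hasDerivAt_pow 2 t).congr_of_eventuallyEq this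

open scoped Classical in
/-- The constraint functions of the branch in which the switching constraint `k` is replaced by
`G k = 0` for `k ∈ S` and by `H k = 0` otherwise. -/
def branchFun (g : Fin m → Vec n → ℝ) (h : Fin p → Vec n → ℝ) (G H : Fin l → Vec n → ℝ)
    (S : Set (Fin l)) : Fin m ⊕ Fin p ⊕ Fin l → Vec n → ℝ :=
  Sum.elim g (Sum.elim h fun k => if k ∈ S then G k else H k)

/-- The violation of an inequality constraint is its positive part, that of an equality constraint
is its value. -/
def violation (m p l : ℕ) : Fin m ⊕ Fin p ⊕ Fin l → ℝ → ℝ :=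
  Sum.elim (fun _ t => max t 0) fun _ t => t

lemma pos_of_mul_violation_pos (i : Fin m ⊕ Fin p ⊕ Fin l) {a t : ℝ}
    (hpos : 0 < a * violation m p l i t) : 0 < a * t := by
  rcases i with i | i
  · simp only [violation, Sum.elim_inl] at hpos
    rcases le_total t 0 with ht | ht
    · simp [ht] at hpos
    · rwa [max_eq_left ht] at hpos
  · exact hpos

lemma hasDerivAt_violation_sq (i : Fin m ⊕ Fin p ⊕ Fin l) (t : ℝ) :
    HasDerivAt (fun s => violation m p l i s ^ 2) (2 * violation m p l i t) t := by
  rcases i with i | i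
  · exact hasDerivAt_max_zero_sq t
  · simpa [violation] using hasDerivAt_pow 2 t

section Residual

variable {g : Fin m → Vec n → ℝ} {h : Fin p → Vec n → ℝ} {G H : Fin l → Vec n → ℝ}

lemma contDiff_branchFun {N : WithTop ℕ∞} (hg : ∀ i, ContDiff ℝ N (g i))
    (hh : ∀ j, ContDiff ℝ N (h j)) (hG : ∀ k, ContDiff ℝ N (G k)) (hH : ∀ k, ContDiff ℝ N (H k))
    (S : Set (Fin l)) (i : Fin m ⊕ Fin p ⊕ Fin l) : ContDiff ℝ N (branchFun g h G H S i) := by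
  rcases i with i | j | k
  · exact hg i
  · exact hh j
  · simp only [branchFun, Sum.elim_inr]
    split_ifs
    exacts [hG k, hH k]

lemma residual_sq (x : Vec n) : residual g h G H x ^ 2 =
    ∑ i, max (g i x) 0 ^ 2 + ∑ j, h j x ^ 2 + ∑ k, min (G k x ^ 2) (H k x ^ 2) :=
  Real.sq_sqrt (by positivity)

lemma residual_nonneg (x : Vec n) : 0 ≤ residual g h G H x := Real.sqrt_nonneg _

lemma residual_eq_zero {x : Vec n} (hx : x ∈ Feas g h G H) : residual g h G H x = 0 := by
  obtain ⟨hxg, hxh, hxGH⟩ := hx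
  have hmin : ∀ k, min (G k x ^ 2) (H k x ^ 2) = 0 := fun k => by
    rcases mul_eq_zero.1 (hxGH k) with h0 | h0 <;> simp [h0, sq_nonneg]
  simp [residual, hxg, hxh, hmin]

lemma mem_feas_of_residual_eq_zero {x : Vec n} (hx : residual g h G H x = 0) :
    x ∈ Feas g h G H := by
  have hsq := residual_sq (g := g) (h := h) (G := G) (H := H) x
  have h1 : 0 ≤ ∑ i, max (g i x) 0 ^ 2 := by positivity
  have h2 : 0 ≤ ∑ j, h j x ^ 2 := by positivity
  have h3 : 0 ≤ ∑ k, min (G k x ^ 2) (H k x ^ 2) := by positivity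
  rw [hx, zero_pow two_ne_zero] at hsq
  have e1 : ∑ i, max (g i x) 0 ^ 2 = 0 := by linarith
  have e2 : ∑ j, h j x ^ 2 = 0 := by linarith
  have e3 : ∑ k, min (G k x ^ 2) (H k x ^ 2) = 0 := by linarith
  rw [Finset.sum_eq_zero_iff_of_nonneg fun _ _ => by positivity] at e1 e2 e3
  refine ⟨fun i => ?_, fun j => ?_, fun k => ?_⟩
  · simpa using e1 i (Finset.mem_univ i)
  · simpa using e2 j (Finset.mem_univ j)
  · have hk := e3 k (Finset.mem_univ k)
    rcases min_choice (G k x ^ 2) (H k x ^ 2) with hc | hc <;> rw [hc] at hk <;>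
      simp [pow_eq_zero_iff two_ne_zero |>.1 hk]

lemma continuous_residual (hg : ∀ i, Continuous (g i)) (hh : ∀ j, Continuous (h j))
    (hG : ∀ k, Continuous (G k)) (hH : ∀ k, Continuous (H k)) :
    Continuous (residual g h G H) := by
  unfold residual
  fun_prop

lemma isClosed_feas (hg : ∀ i, Continuous (g i)) (hh : ∀ j, Continuous (h j))
    (hG : ∀ k, Continuous (G k)) (hH : ∀ k, Continuous (H k)) : IsClosed (Feas g h G H) := by
  have : Feas g h G H = residual g h G H ⁻¹' {0} :=
    Set.ext fun x => ⟨residual_eq_zero, mem_feas_of_residual_eq_zero⟩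
  rw [this]
  exact isClosed_singleton.preimage (continuous_residual hg hh hG hH)

lemma sum_violation_branchFun_sq (S : Set (Fin l)) (x : Vec n) [DecidablePred (· ∈ S)] :
    ∑ i, violation m p l i (branchFun g h G H S i x) ^ 2 =
      ∑ i, max (g i x) 0 ^ 2 + ∑ j, h j x ^ 2 +
        ∑ k, if k ∈ S then G k x ^ 2 else H k x ^ 2 := by
  simp only [Fintype.sum_sum_type, violation, branchFun, Sum.elim_inl, Sum.elim_inr, ← add_assoc]
  congr 1
  refine Finset.sum_congr rfl fun k _ => ?_
  split_ifs <;> rfl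

lemma residual_sq_le_sum_violation_sq (S : Set (Fin l)) (x : Vec n) :
    residual g h G H x ^ 2 ≤ ∑ i, violation m p l i (branchFun g h G H S i x) ^ 2 := by
  classical
  rw [residual_sq, sum_violation_branchFun_sq]
  gcongr with k
  split_ifs
  exacts [min_le_left _ _, min_le_right _ _]

lemma sum_violation_sq_eq_residual_sq {S : Set (Fin l)} {x : Vec n}
    (hS : ∀ k, k ∈ S ↔ G k x ^ 2 ≤ H k x ^ 2) :
    ∑ i, violation m p l i (branchFun g h G H S i x) ^ 2 = residual g h G H x ^ 2 := by
  classical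
  rw [residual_sq, sum_violation_branchFun_sq]
  congr 1
  refine Finset.sum_congr rfl fun k _ => ?_
  split_ifs with hk
  · rw [min_eq_left ((hS k).1 hk)]
  · rw [min_eq_right (not_le.1 (mt (hS k).2 hk)).le]

lemma hasFDerivAt_sum_violation_sq {ι : Type*} [Fintype ι] {E : Type*} [NormedAddCommGroup E]
    [NormedSpace ℝ E] {φ : ι → E → ℝ} {θ : ι → ℝ → ℝ} {x : E}
    (hφ : ∀ i, DifferentiableAt ℝ (φ i) x)
    (hθ : ∀ i t, HasDerivAt (fun s => θ i s ^ 2) (2 * θ i t) t) :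
    HasFDerivAt (fun y => ∑ i, θ i (φ i y) ^ 2)
      (∑ i, (2 * θ i (φ i x)) • fderiv ℝ (φ i) x) x :=
  HasFDerivAt.fun_sum fun i _ => (hθ i (φ i x)).comp_hasFDerivAt x (hφ i).hasFDerivAt

end Residual

section Hessian

/-- The inverse Riesz isomorphism, as a real-linear map. -/
def toDualSymmL (E : Type*) [NormedAddCommGroup E] [InnerProductSpace ℝ E] [CompleteSpace E] :
    StrongDual ℝ E →L[ℝ] E where
  toFun := (InnerProductSpace.toDual ℝ E).symm
  map_add' := map_add _
  map_smul' a L := by simp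
  cont := (InnerProductSpace.toDual ℝ E).symm.continuous

lemma hasFDerivAt_gradient {φ : Vec n → ℝ} (hφ : ContDiff ℝ 2 φ) (x : Vec n) :
    HasFDerivAt (gradient φ)
      ((toDualSymmL (Vec n)).comp (fderiv ℝ (fderiv ℝ φ) x)) x := by
  have hdiff : DifferentiableAt ℝ (fderiv ℝ φ) x :=
    (hφ.fderiv_right (m := 1) (by norm_num)).differentiable one_ne_zero x
  exact (toDualSymmL (Vec n)).hasFDerivAt.comp x hdiff.hasFDerivAt

/-- Under constant rank of the gradients near `x`, a vanishing combination of the gradients at `x`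
yields a vanishing combination of the Hessian forms on the critical subspace. -/
lemma sum_hessForm_eq_zero_of_constant_rank {ι : Type*} [Fintype ι] {φ : ι → Vec n → ℝ}
    (hφ : ∀ i, ContDiff ℝ 2 (φ i)) {x : Vec n} {T : Set ι}
    (hrank : ∀ᶠ y in 𝓝 x, Module.finrank ℝ (Submodule.span ℝ ((fun i => gradient (φ i) y) '' T)) =
      Module.finrank ℝ (Submodule.span ℝ ((fun i => gradient (φ i) x) '' T)))
    {c : ι → ℝ} (hcT : ∀ i ∉ T, c i = 0) (hc : ∑ i, c i • gradient (φ i) x = 0)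
    {d : Vec n} (hd : ∀ i ∈ T, fderiv ℝ (φ i) x d = 0) :
    ∑ i, c i * hessForm (φ i) x d = 0 := by
  have key := sum_inner_eq_zero_of_constant_rank (fun i => hasFDerivAt_gradient (hφ i) x) hrank
    hcT hc (d := d) (fun i hi => by
      rw [gradient, InnerProductSpace.toDual_symm_apply, hd i hi])
  rw [← key]
  refine Finset.sum_congr rfl fun i _ => ?_
  congr 1
  rw [hessForm, iteratedFDeriv_two_apply]
  exact (InnerProductSpace.toDual_symm_apply (x := d)).symm

end Hessian

section Branch

variable {g : Fin m → Vec n → ℝ} {h : Fin p → Vec n → ℝ} {G H : Fin l → Vec n → ℝ} {xb : Vec n}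

lemma IG_union_eq {S : Set (Fin l)} (hxb : ∀ k, G k xb * H k xb = 0)
    (hS : ∀ k ∈ S, G k xb ^ 2 ≤ H k xb ^ 2) (hS' : ∀ k ∉ S, H k xb ^ 2 ≤ G k xb ^ 2) :
    IG G H xb ∪ (S ∩ IGH G H xb) = S := by
  ext k
  constructor
  · rintro (⟨hGk, hHk⟩ | hk)
    · by_contra hkS
      have := hS' k hkS
      rw [hGk, zero_pow two_ne_zero] at this
      exact hHk (pow_eq_zero_iff two_ne_zero |>.1 (this.antisymm (sq_nonneg _)))
    · exact hk.1
  · intro hk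
    have hGk : G k xb = 0 := by
      rcases mul_eq_zero.1 (hxb k) with h0 | h0
      · exact h0
      · have := hS k hk
        rw [h0, zero_pow two_ne_zero] at this
        exact pow_eq_zero_iff two_ne_zero |>.1 (this.antisymm (sq_nonneg _))
    by_cases hHk : H k xb = 0
    · exact Or.inr ⟨hk, hGk, hHk⟩
    · exact Or.inl ⟨hGk, hHk⟩

lemma IH_union_eq {S : Set (Fin l)} (hxb : ∀ k, G k xb * H k xb = 0)
    (hS : ∀ k ∈ S, G k xb ^ 2 ≤ H k xb ^ 2) (hS' : ∀ k ∉ S, H k xb ^ 2 ≤ G k xb ^ 2) :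
    IH G H xb ∪ (Sᶜ ∩ IGH G H xb) = Sᶜ := by
  have := IG_union_eq (G := H) (H := G) (S := Sᶜ) (xb := xb)
    (fun k => by rw [mul_comm]; exact hxb k) (fun k hk => hS' k hk)
    (fun k hk => hS k (not_not.1 hk))
  simpa only [IG, IH, IGH, and_comm] using this

lemma partition_inter_compl (S : Set (Fin l)) :
    Partition G H xb (S ∩ IGH G H xb) (Sᶜ ∩ IGH G H xb) := by
  constructor
  · rw [← Set.inter_inter_distrib_right, Set.inter_compl_self, Set.empty_inter]
  · rw [← Set.union_inter_distrib_right, Set.union_compl_self, Set.univ_inter]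

/-- The indices of the active constraints of a branch. -/
def activeSet (g : Fin m → Vec n → ℝ) (p l : ℕ) (xb : Vec n) : Set (Fin m ⊕ Fin p ⊕ Fin l) :=
  {i | ∀ j, i = Sum.inl j → j ∈ Ig g xb}

lemma gradRank_eq_finrank_span (S : Set (Fin l)) (x : Vec n) :
    gradRank g h G H (Ig g xb) S Sᶜ x = Module.finrank ℝ (Submodule.span ℝ
      ((fun i => gradient (branchFun g h G H S i) x) '' activeSet g p l xb)) := by
  unfold gradRank
  refine congrArg (fun A : Set (Vec n) => Module.finrank ℝ (Submodule.span ℝ A))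
    (Set.ext fun w => ?_)
  simp only [Set.mem_union, Set.mem_image, Set.mem_range, Sum.exists]
  constructor
  · rintro (((⟨i, hi, rfl⟩ | ⟨j, rfl⟩) | ⟨k, hk, rfl⟩) | ⟨k, hk, rfl⟩)
    · exact Or.inl ⟨i, fun j hj => Sum.inl_injective hj ▸ hi, rfl⟩
    · exact Or.inr (Or.inl ⟨j, fun _ hj => by simp at hj, rfl⟩)
    · exact Or.inr (Or.inr ⟨k, fun _ hj => by simp at hj, by simp [branchFun, hk]⟩)
    · exact Or.inr (Or.inr ⟨k, fun _ hj => by simp at hj, by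
        simp [branchFun, show k ∉ S from hk]⟩)
  · rintro (⟨i, hi, rfl⟩ | ⟨j, -, rfl⟩ | ⟨k, -, rfl⟩)
    · exact Or.inl (Or.inl (Or.inl ⟨i, hi i rfl, rfl⟩))
    · exact Or.inl (Or.inl (Or.inr ⟨j, rfl⟩))
    · by_cases hk : k ∈ S
      · exact Or.inl (Or.inr ⟨k, hk, by simp [branchFun, hk]⟩)
      · exact Or.inr ⟨k, hk, by simp [branchFun, hk]⟩

/-- Under piecewise constant rank, second-order quasi-normality rules out nonzero quasi-normal
multipliers of any branch: the second-order condition holds automatically. -/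
lemma multiplier_eq_zero_of_PWCR_of_PSOQN
    (hg : ∀ i, ContDiff ℝ 2 (g i)) (hh : ∀ j, ContDiff ℝ 2 (h j))
    (hG : ∀ k, ContDiff ℝ 2 (G k)) (hH : ∀ k, ContDiff ℝ 2 (H k))
    (hxb : xb ∈ Feas g h G H) (hpwcr : PWCR g h G H xb) (hqn : PSOQN g h G H xb)
    {S : Set (Fin l)} (hS : ∀ k ∈ S, G k xb ^ 2 ≤ H k xb ^ 2)
    (hS' : ∀ k ∉ S, H k xb ^ 2 ≤ G k xb ^ 2)
    {Λ : Fin m ⊕ Fin p ⊕ Fin l → ℝ} (hΛ : ∀ i, 0 ≤ Λ (Sum.inl i))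
    (hsum : ∑ i, Λ i • fderiv ℝ (branchFun g h G H S i) xb = 0)
    (hfreq : ∃ᶠ x in 𝓝 xb, ∀ i, Λ i ≠ 0 → 0 < Λ i * branchFun g h G H S i x) : Λ = 0 := by
  classical
  obtain ⟨xs, hxs, hpos⟩ := exists_seq_forall_of_frequently hfreq
  by_contra hne
  have hpart := partition_inter_compl (G := G) (H := H) (xb := xb) S
  have hIG := IG_union_eq hxb.2.2 hS hS'
  have hIH := IH_union_eq hxb.2.2 hS hS'
  have hgrad : ∑ i, Λ i • gradient (branchFun g h G H S i) xb = 0 := by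
    have := congrArg (toDualSymmL (Vec n)) hsum
    simp only [map_sum, map_zero, map_smul] at this
    exact this
  have hactive : ∀ i ∉ activeSet g p l xb, Λ i = 0 := by
    rintro i hi
    simp only [activeSet, Set.mem_ofPred_eq, not_forall] at hi
    obtain ⟨j, rfl, hj⟩ := hi
    by_contra h0
    refine hj (le_antisymm (hxb.1 j) ?_)
    refine ge_of_tendsto (((hg j).continuous.tendsto xb).comp hxs) (.of_forall fun s => ?_)
    exact (pos_of_mul_pos_right (hpos s _ h0) (hΛ j)).le
  obtain ⟨ε, hε, hrank⟩ := hpwcr _ _ hpart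
  rw [hIG, hIH] at hrank
  have hrank' : ∀ᶠ y in 𝓝 xb, Module.finrank ℝ (Submodule.span ℝ
      ((fun i => gradient (branchFun g h G H S i) y) '' activeSet g p l xb)) =
      Module.finrank ℝ (Submodule.span ℝ
        ((fun i => gradient (branchFun g h G H S i) xb) '' activeSet g p l xb)) := by
    filter_upwards [ball_mem_nhds xb hε] with y hy
    rw [← gradRank_eq_finrank_span, ← gradRank_eq_finrank_span]
    exact hrank y (by rwa [mem_ball, dist_eq_norm] at hy)
  have hsplit : ∀ {β : Type} [AddCommMonoid β] (F : Fin m ⊕ Fin p ⊕ Fin l → β) (F₁ F₂ : Fin l → β),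
      (∀ k, F (Sum.inr (Sum.inr k)) = F₁ k + F₂ k) →
      ∑ i, F i = ∑ i, F (Sum.inl i) + ∑ j, F (Sum.inr (Sum.inl j)) + ∑ k, F₁ k + ∑ k, F₂ k := by
    intro β _ F F₁ F₂ hF
    simp only [Fintype.sum_sum_type, hF, Finset.sum_add_distrib, add_assoc]
  refine hqn _ _ hpart ⟨fun i => Λ (Sum.inl i), fun j => Λ (Sum.inr (Sum.inl j)),
    fun k => if k ∈ S then Λ (Sum.inr (Sum.inr k)) else 0,
    fun k => if k ∈ S then 0 else Λ (Sum.inr (Sum.inr k)), hΛ, ?_, ?_, ?_, ?_, ?_, xs, hxs, ?_⟩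
  · rw [hIG]
    intro k hk
    simp [hk]
  · rw [hIH]
    intro k hk
    simp [not_not.1 hk]
  · rintro ⟨h1, h2, h3, h4⟩
    refine hne (funext fun i => ?_)
    rcases i with i | j | k
    · exact congrFun h1 i
    · exact congrFun h2 j
    · by_cases hk : k ∈ S
      · simpa [hk] using congrFun h3 k
      · simpa [hk] using congrFun h4 k
  · rw [← hgrad]
    refine (hsplit (fun i => Λ i • gradient (branchFun g h G H S i) xb)
      (fun k => (if k ∈ S then Λ (Sum.inr (Sum.inr k)) else 0) • gradient (G k) xb)
      (fun k => (if k ∈ S then 0 else Λ (Sum.inr (Sum.inr k))) • gradient (H k) xb)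
      fun k => ?_).symm
    by_cases hk : k ∈ S <;> simp [hk, branchFun]
  · rw [hIG, hIH]
    intro d hdg hdh hdG hdH
    have hvanish : ∑ i, Λ i * hessForm (branchFun g h G H S i) xb d = 0 := by
      refine sum_hessForm_eq_zero_of_constant_rank (contDiff_branchFun hg hh hG hH S)
        hrank' hactive hgrad ?_
      rintro (i | j | k) hi
      · exact hdg i (hi i rfl)
      · exact hdh j
      · by_cases hk : k ∈ S
        · simpa [branchFun, hk] using hdG k hk
        · simpa [branchFun, hk] using hdH k hk
    refine hvanish.ge.trans (hsplit (fun i => Λ i * hessForm (branchFun g h G H S i) xb d)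
      (fun k => (if k ∈ S then Λ (Sum.inr (Sum.inr k)) else 0) * hessForm (G k) xb d)
      (fun k => (if k ∈ S then 0 else Λ (Sum.inr (Sum.inr k))) * hessForm (H k) xb d)
      fun k => ?_).le
    by_cases hk : k ∈ S <;> simp [hk, branchFun]
  · refine fun s => ⟨fun i hi => hpos s _ hi.ne', fun j hj => hpos s _ hj, fun k hk => ?_,
      fun k hk => ?_⟩
    · have hkS : k ∈ S := by by_contra hkS; simp [hkS] at hk
      simpa [branchFun, hkS] using hpos s (Sum.inr (Sum.inr k)) (by simpa [hkS] using hk)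
    · have hkS : k ∉ S := by intro hkS; simp [hkS] at hk
      simpa [branchFun, hkS] using hpos s (Sum.inr (Sum.inr k)) (by simpa [hkS] using hk)

end Branch

section ErrorBound

variable {g : Fin m → Vec n → ℝ} {h : Fin p → Vec n → ℝ} {G H : Fin l → Vec n → ℝ} {xb : Vec n}

/-- Local error bound: near `xb` the residual controls the distance to the feasible set. -/
theorem exists_infDist_feas_le_mul_residual
    (hg : ∀ i, ContDiff ℝ 2 (g i)) (hh : ∀ j, ContDiff ℝ 2 (h j))
    (hG : ∀ k, ContDiff ℝ 2 (G k)) (hH : ∀ k, ContDiff ℝ 2 (H k))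
    (hxb : xb ∈ Feas g h G H) (hpwcr : PWCR g h G H xb) (hqn : PSOQN g h G H xb) :
    ∃ c > (0 : ℝ), ∃ ε > (0 : ℝ), ∀ x, ‖x - xb‖ < ε →
      infDist x (Feas g h G H) ≤ c * residual g h G H x := by
  by_contra! hcon
  have hcontR : Continuous (residual g h G H) := continuous_residual
    (fun i => (hg i).continuous) (fun i => (hh i).continuous) (fun i => (hG i).continuous)
    fun i => (hH i).continuous
  choose x hx hdist using fun N : ℕ => hcon (N + 1) (by positivity) (1 / (N + 1)) (by positivity)
  have hδ : ∀ N, 0 < infDist (x N) (Feas g h G H) := fun N =>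
    (mul_nonneg (by positivity) (residual_nonneg _)).trans_lt (hdist N)
  have hpos : ∀ N, ∀ y ∈ closedBall (x N) (infDist (x N) (Feas g h G H) / 2),
      0 < residual g h G H y := by
    intro N y hy
    refine (residual_nonneg y).lt_of_ne fun h0 => ?_
    have h1 := infDist_le_dist_of_mem (x := x N) (mem_feas_of_residual_eq_zero h0.symm)
    rw [mem_closedBall, dist_comm] at hy
    linarith [hδ N]
  choose u hu hQ using fun N => exists_touching_fderiv_le hcontR (hδ N) (hpos N)
  have hux : Tendsto u atTop (𝓝 xb) := by
    have h0 : Tendsto (fun N : ℕ => 2 * (1 / ((N : ℝ) + 1))) atTop (𝓝 0) := by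
      simpa using tendsto_one_div_add_atTop_nhds_zero_nat.const_mul (2 : ℝ)
    refine tendsto_iff_dist_tendsto_zero.2 (squeeze_zero (fun _ => dist_nonneg) (fun N => ?_) h0)
    have h1 : dist (u N) (x N) < infDist (x N) (Feas g h G H) / 2 := hu N
    have h2 : infDist (x N) (Feas g h G H) ≤ dist (x N) xb := infDist_le_dist_of_mem hxb
    have h3 : dist (x N) xb < 1 / (N + 1) := by rw [dist_eq_norm]; exact hx N
    linarith [dist_triangle (u N) (x N) xb, hδ N]
  let U : Ultrafilter ℕ := hyperfilter ℕ
  have hU : (U : Filter ℕ) ≤ atTop := Nat.hyperfilter_le_atTop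
  have huU : Tendsto u U (𝓝 xb) := hux.mono_left hU
  set S : Set (Fin l) := {k | ∀ᶠ N in U, G k (u N) ^ 2 ≤ H k (u N) ^ 2} with hSdef
  have hSc : ∀ k ∉ S, ∀ᶠ N in U, ¬ G k (u N) ^ 2 ≤ H k (u N) ^ 2 := fun k hk =>
    Ultrafilter.eventually_not.2 hk
  have hlimG : ∀ k, Tendsto (fun N => G k (u N) ^ 2) U (𝓝 (G k xb ^ 2)) := fun k =>
    (((hG k).continuous.tendsto xb).comp huU).pow 2
  have hlimH : ∀ k, Tendsto (fun N => H k (u N) ^ 2) U (𝓝 (H k xb ^ 2)) := fun k =>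
    (((hH k).continuous.tendsto xb).comp huU).pow 2
  have hSx : ∀ k ∈ S, G k xb ^ 2 ≤ H k xb ^ 2 := fun k hk =>
    le_of_tendsto_of_tendsto (hlimG k) (hlimH k) hk
  have hSx' : ∀ k ∉ S, H k xb ^ 2 ≤ G k xb ^ 2 := fun k hk =>
    le_of_tendsto_of_tendsto (hlimH k) (hlimG k) ((hSc k hk).mono fun _ hN => (not_le.1 hN).le)
  have hSU : ∀ᶠ N in U, ∀ k, k ∈ S ↔ G k (u N) ^ 2 ≤ H k (u N) ^ 2 := by
    refine eventually_all.2 fun k => ?_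
    by_cases hk : k ∈ S
    · exact Eventually.mono hk fun N hN => by simp [hk, hN]
    · exact (hSc k hk).mono fun N hN => by simp [hk, hN]
  have hr2 : ∀ᶠ N in U, ∑ i, violation m p l i (branchFun g h G H S i (u N)) ^ 2 =
      residual g h G H (u N) ^ 2 := hSU.mono fun N hN => sum_violation_sq_eq_residual_sq hN
  have hη : Tendsto (fun N : ℕ => 8 * (1 / ((N : ℝ) + 1))) U (𝓝 0) := by
    simpa using (tendsto_one_div_add_atTop_nhds_zero_nat.const_mul (8 : ℝ)).mono_left hU
  have hr : ∀ N, 0 < residual g h G H (u N) := fun N => hpos N _ (ball_subset_closedBall (hu N))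
  have hC2 := contDiff_branchFun hg hh hG hH S
  obtain ⟨Λ, hΛ1, hΛ0, hΛlim, hΛpos⟩ := exists_limit_multipliers
    (fun i => (hC2 i).of_le (by norm_num)) (fun i _ _ => pos_of_mul_violation_pos i) huU
    (.of_forall hr) hr2 hη (by
      filter_upwards [hr2] with N hN
      refine (hQ N _ _ (hasFDerivAt_sum_violation_sq
        (fun i => (hC2 i).differentiable two_ne_zero (u N)) hasDerivAt_violation_sq)
        (fun y => residual_sq_le_sum_violation_sq S y) hN).trans ?_
      refine mul_le_mul_of_nonneg_left ?_ (mul_nonneg zero_le_two (hr N).le)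
      rw [div_le_iff₀ (hδ N)]
      have := (hdist N).le
      have hN1 : (0 : ℝ) < N + 1 := by positivity
      rw [mul_assoc, one_div, inv_mul_eq_div]
      refine mul_le_mul_of_nonneg_left ?_ (by norm_num)
      rwa [le_div_iff₀ hN1, mul_comm])
  have hzero : Λ = 0 := by
    refine multiplier_eq_zero_of_PWCR_of_PSOQN hg hh hG hH hxb hpwcr hqn hSx hSx' (fun i => ?_)
      hΛ0 (huU.frequently (Eventually.frequently ?_))
    · exact ge_of_tendsto (hΛlim _) (.of_forall fun N =>
        div_nonneg (le_max_right _ _) (hr N).le)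
    · refine eventually_all.2 fun i => ?_
      by_cases hi : Λ i = 0
      · simp [hi]
      · exact (hΛpos i hi).mono fun N hN _ => hN
  simp [hzero] at hΛ1

end ErrorBound

theorem pwcr_psoqn_implies_exact_penalty {n m p l : ℕ} (f : Vec n → ℝ) (g : Fin m → Vec n → ℝ)
    (h : Fin p → Vec n → ℝ) (G H : Fin l → Vec n → ℝ)
    (hf : ContDiff ℝ 2 f) (hg : ∀ i, ContDiff ℝ 2 (g i)) (hh : ∀ j, ContDiff ℝ 2 (h j))
    (hG : ∀ k, ContDiff ℝ 2 (G k)) (hH : ∀ k, ContDiff ℝ 2 (H k))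
    (xb : Vec n) (hxb : xb ∈ Feas g h G H)
    (hopt : LocallyOptimal f g h G H xb)
    (hpwcr : PWCR g h G H xb) (hqn : PSOQN g h G H xb) :
    ∃ κbar > (0:ℝ), ∀ κ : ℝ, κbar < κ →
      ∃ ε' > (0:ℝ), ∀ x : Vec n, ‖x - xb‖ < ε' →
        Pen f g h G H κ xb ≤ Pen f g h G H κ x := by
  obtain ⟨c, hc, ε₁, hε₁, herr⟩ :=
    exists_infDist_feas_le_mul_residual hg hh hG hH hxb hpwcr hqn
  obtain ⟨-, ε₂, hε₂, hmin⟩ := hopt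
  obtain ⟨L, t, ht, hL⟩ :=
    (hf.contDiffAt (x := xb)).of_le (m := 1) (by norm_num) |>.exists_lipschitzOnWith
  obtain ⟨ε₃, hε₃, hball⟩ := Metric.mem_nhds_iff.1 ht
  have hclosed : IsClosed (Feas g h G H) := isClosed_feas (fun i => (hg i).continuous)
    (fun i => (hh i).continuous) (fun i => (hG i).continuous) fun i => (hH i).continuous
  refine ⟨L * c + 1, by positivity, fun κ hκ =>
    ⟨min ε₁ (min ε₂ ε₃ / 2), by positivity, fun x hx => ?_⟩⟩
  have hx1 : ‖x - xb‖ < ε₁ := hx.trans_le (min_le_left _ _)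
  have hx2 : ‖x - xb‖ < min ε₂ ε₃ / 2 := hx.trans_le (min_le_right _ _)
  obtain ⟨y, hy, hxy⟩ := hclosed.exists_infDist_eq_dist ⟨xb, hxb⟩ x
  have hxyle : dist x y ≤ ‖x - xb‖ := by
    rw [← hxy, ← dist_eq_norm]
    exact infDist_le_dist_of_mem hxb
  have hyb : dist y xb < min ε₂ ε₃ := by
    have := dist_triangle_left y xb x
    rw [dist_eq_norm x xb] at this
    linarith
  have hfy : f xb ≤ f y := hmin y hy (by
    rw [← dist_eq_norm]; exact hyb.trans_le (min_le_left _ _))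
  have hfxy : f y - f x ≤ L * dist x y := by
    have h1 := hL.dist_le_mul y (hball (hyb.trans_le (min_le_right _ _))) x (hball (by
      rw [mem_ball, dist_eq_norm]
      have := min_le_right ε₂ ε₃
      linarith))
    rw [dist_comm y x] at h1
    exact (le_abs_self _).trans h1
  have hbound : L * dist x y ≤ L * (c * residual g h G H x) :=
    mul_le_mul_of_nonneg_left (hxy ▸ herr x hx1) L.2
  have hκR : (L * c) * residual g h G H x ≤ κ * residual g h G H x :=
    mul_le_mul_of_nonneg_right (by linarith) (residual_nonneg x)
  rw [Pen, Pen, residual_eq_zero hxb]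
  linarith [mul_assoc (L : ℝ) c (residual g h G H x)]

end MPSC
end
end
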